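/- (Theorem 3.9, parts iii–iv) Assume 0<h<2 with 2/h∉ℤ, h small and L large; set λ=⌊2/h⌋+1 and define the protocritical height Γ := −2hλ² + 2λ(4+h) − 2h. For the PCA started from the all-minus configuration −1̲, for every ε>0: ℙ_{−1̲}( e^{βΓ−βε} < τ_𝒞 < e^{βΓ+βε} ) → 1 as β→∞, and ℙ_{−1̲}( e^{βΓ−βε} < τ_{+1̲} < e^{βΓ+βε} ) → 1 as β→∞. -/

import Mathlib

open scoped BigOperators Classical
open Filter

namespace PCA

/-- Sites of the two-dimensional discrete torus of side `L`. -/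
abbrev Site (L : ℕ) := ZMod L × ZMod L

/-- Spin configurations: `true` codes the spin `+1`, `false` codes `-1`. -/
abbrev Config (L : ℕ) := Site L → Bool

noncomputable section

/-- The real value of a spin. -/
def spin (b : Bool) : ℝ := if b then 1 else -1

def east (L : ℕ) : Site L := (1, 0)
def north (L : ℕ) : Site L := (0, 1)

variable {L : ℕ}

/-- `S_σ(x)`: the sum of the spins of the four nearest neighbours of `x`. -/
def nnS (σ : Config L) (x : Site L) : ℝ :=
  spin (σ (x + east L)) + spin (σ (x - east L)) +
    spin (σ (x + north L)) + spin (σ (x - north L))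

/-- Single-site heat-bath probability `p_x(a|σ)`. -/
def flipP (β h : ℝ) (σ : Config L) (x : Site L) (a : Bool) : ℝ :=
  1 / (1 + Real.exp (-2 * β * spin a * (nnS σ x + h)))

/-- The PCA transition matrix `P(σ,η) = ∏_x p_x(η(x)|σ)`. -/
def Pmat (β h : ℝ) [NeZero L] (σ η : Config L) : ℝ :=
  ∏ x : Site L, flipP β h σ x (η x)

/-- The four-body Hamiltonian `H_β`. -/
def Ham (β h : ℝ) [NeZero L] (σ : Config L) : ℝ :=
  -(β * h) * ∑ x : Site L, spin (σ x)
    - ∑ x : Site L, Real.log (Real.cosh (β * (nnS σ x + h)))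

/-- The zero-temperature energy `E`. -/
def En (h : ℝ) [NeZero L] (σ : Config L) : ℝ :=
  -h * ∑ x : Site L, spin (σ x) - ∑ x : Site L, |nnS σ x + h|

/-- The zero-temperature drift map `T`. -/
def T (h : ℝ) (σ : Config L) : Config L :=
  fun x => if 0 < nnS σ x + h then true else false

def plusC (L : ℕ) : Config L := fun _ => true
def minusC (L : ℕ) : Config L := fun _ => false

/-- The even chessboard `C_e(x) = (-1)^(x₁+x₂)` (`true` at even-parity sites). -/
def chessE (L : ℕ) : Config L := fun x => decide ((x.1 + x.2).val % 2 = 0)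
def chessO (L : ℕ) : Config L := fun x => !(chessE L x)
def chessSet (L : ℕ) : Set (Config L) := {chessE L, chessO L}

def IsChessCfg {L : ℕ} (C : Config L) : Prop := C = chessE L ∨ C = chessO L

/-- A trap: a stable configuration or an element of a stable pair. -/
def IsTrap (h : ℝ) (σ : Config L) : Prop := T h σ = σ ∨ T h (T h σ) = σ

/-- The trap `σ̂` reached by the downhill path started at `σ`. -/
def hatTrap (h : ℝ) (σ : Config L) : Config L :=
  (T h)^[sInf {n | IsTrap h ((T h)^[n] σ)}] σ

/-- The basin of attraction `𝔅(ζ)` of a trap `ζ`. -/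
def basin (h : ℝ) (ζ : Config L) : Set (Config L) := {σ | hatTrap h σ = ζ}

/-- The interior of a rectangle on the dual lattice: an `a × b` block of sites
with lower-left corner `c`. -/
def rect (c : Site L) (a b : ℕ) : Set (Site L) :=
  { y | ∃ i j : ℕ, i < a ∧ j < b ∧ y = c + ((i : ZMod L), (j : ZMod L)) }

/-- The configuration equal to `ζ` inside the given rectangle and to `bg` outside. -/
def rectCfg (bg ζ : Config L) (c : Site L) (a b : ℕ) : Config L :=
  fun x => if x ∈ rect c a b then ζ x else bg x

/-- Differences between sites at euclidean distance at most `2` on the torus. -/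
def closeDiff (d : Site L) : Prop :=
  ∃ u v : ℤ, u ^ 2 + v ^ 2 ≤ 4 ∧ d = ((u : ZMod L), (v : ZMod L))

/-- Two sets of sites are non-interacting iff all pairs of sites are at
euclidean distance `> 2` (equivalently `≥ √5`). -/
def NonInteracting (A B : Set (Site L)) : Prop :=
  ∀ x ∈ A, ∀ y ∈ B, ¬ closeDiff (y - x)

/-- Nearest-neighbour adjacency on the torus. -/
def Adj (x y : Site L) : Prop :=
  y = x + east L ∨ y = x - east L ∨ y = x + north L ∨ y = x - north L

def stepSet : Set (ℤ × ℤ) := {(1, 0), (-1, 0), (0, 1), (0, -1)}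

/-- `X` contains a nearest-neighbour loop winding around the torus
(a percolating, torus-wrapping, cluster is a cluster containing such a loop). -/
def Wrapping (X : Set (Site L)) : Prop :=
  ∃ (n : ℕ) (f : ℕ → Site L) (d : ℕ → ℤ × ℤ),
    0 < n ∧ f n = f 0 ∧ (∑ i ∈ Finset.range n, d i) ≠ 0 ∧
    ∀ i < n, d i ∈ stepSet ∧
      f (i + 1) = f i + (((d i).1 : ZMod L), ((d i).2 : ZMod L)) ∧ f i ∈ X

/-- `σ` has a well defined sea of the homogeneous phase `α`. -/
def SeaHom (h : ℝ) (α σ : Config L) : Prop :=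
  ∃ X : Set (Site L), Wrapping X ∧ (∀ x ∈ X, σ x = α x) ∧
    ∀ n : ℕ, 1 ≤ n → ∀ x ∈ X, (T h)^[n] σ x = α x

/-- `σ` has a well defined sea of the chessboard `C`. -/
def SeaChess (h : ℝ) (C σ : Config L) : Prop :=
  ∃ X : Set (Site L), Wrapping X ∧ (∀ x ∈ X, σ x = C x) ∧
    ∀ n : ℕ, 1 ≤ n → ∀ x ∈ X, (T h)^[2 * n] σ x = C x

def SeaMinus (h : ℝ) (σ : Config L) : Prop := SeaHom h (minusC L) σ
def SeaPlus (h : ℝ) (σ : Config L) : Prop := SeaHom h (plusC L) σ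
def SeaChessAny (h : ℝ) (σ : Config L) : Prop :=
  SeaChess h (chessE L) σ ∨ SeaChess h (chessO L) σ

/-- Communication height `H(σ,η) = H(σ) - log P(σ,η)`. -/
def commH (β h : ℝ) [NeZero L] (σ η : Config L) : ℝ :=
  Ham β h σ - Real.log (Pmat β h σ η)

/-- Minimal height (minmax) `Φ(σ,η)` over all paths from `σ` to `η`. -/
def Phi (β h : ℝ) [NeZero L] (σ η : Config L) : ℝ :=
  sInf { v | ∃ (n : ℕ) (f : ℕ → Config L), 0 < n ∧ f 0 = σ ∧ f n = η ∧
    v = sSup { w | ∃ i < n, w = commH β h (f i) (f (i + 1)) } }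

/-- The barrier `Υ(η) = min_{ζ ∉ 𝔅(η)} Φ(η,ζ)` to exit the basin of the trap `η`. -/
def Ups (β h : ℝ) [NeZero L] (η : Config L) : ℝ :=
  sInf { v | ∃ ζ : Config L, ζ ∉ basin h η ∧ v = Phi β h η ζ }

/-- Probability, starting from `σ0`, that the first visit to `E` happens
at time `n` and at a state of `F`. -/
def firstHitP (β h : ℝ) [NeZero L] (σ0 : Config L) (E F : Set (Config L)) (n : ℕ) : ℝ :=
  ∑ f : Fin (n + 1) → Config L,
    if f 0 = σ0 ∧ (∀ i : Fin (n + 1), (i : ℕ) < n → f i ∉ E) ∧ f (Fin.last n) ∈ E ∩ F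
    then ∏ i : Fin n, Pmat β h (f i.castSucc) (f i.succ) else 0

/-- `ℙ_{σ0}(τ_A < τ_B)`. -/
def probHitBefore (β h : ℝ) [NeZero L] (σ0 : Config L) (A B : Set (Config L)) : ℝ :=
  ∑' n : ℕ, firstHitP β h σ0 (A ∪ B) (A \ B) n

/-- `ℙ_{σ0}(τ_D ∈ I)` (for `τ_D < ∞`). -/
def probTauIn (β h : ℝ) [NeZero L] (σ0 : Config L) (D : Set (Config L)) (I : Set ℝ) : ℝ :=
  ∑' n : ℕ, if (n : ℝ) ∈ I then firstHitP β h σ0 D Set.univ n else 0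

/-- `ℙ_{σ0}(τ_D > t)` (including the event that `D` is never visited). -/
def probTauGT (β h : ℝ) [NeZero L] (σ0 : Config L) (D : Set (Config L)) (t : ℝ) : ℝ :=
  1 - probTauIn β h σ0 D (Set.Iic t)

/-- `ℙ_{σ0}(σ_{τ_E} ∈ F)`. -/
def probFirstHitIn (β h : ℝ) [NeZero L] (σ0 : Config L) (E F : Set (Config L)) : ℝ :=
  ∑' n : ℕ, firstHitP β h σ0 E F n

/-- The critical length `λ = ⌊2/h⌋ + 1`. -/
def lam (h : ℝ) : ℕ := Nat.floor (2 / h) + 1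

/-- The protocritical height `Γ = -2hλ² + 2λ(4+h) - 2h`. -/
def Gam (h : ℝ) : ℝ :=
  -2 * h * (lam h : ℝ) ^ 2 + 2 * (lam h : ℝ) * (4 + h) - 2 * h

/-- The geometric conditions of Proposition 3.3 (iii) for a trap in the sea of
minuses, with `s` chessboard rectangles (indices `< s`) and `k - s` plus
rectangles (indices `≥ s`). -/
def MinusMultiSpec (h : ℝ) (σ : Config L) (s : ℕ) {k : ℕ}
    (c : Fin k → Site L) (a b : Fin k → ℕ) : Prop :=
  1 ≤ k ∧ s ≤ k ∧
  (∀ i, 2 ≤ min (a i) (b i) ∧ max (a i) (b i) ≤ L - 2) ∧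
  (∀ i j, i ≠ j → Disjoint (rect (c i) (a i) (b i)) (rect (c j) (a j) (b j))) ∧
  (∀ j i : Fin k, (j : ℕ) < s → s ≤ (i : ℕ) →
    NonInteracting (rect (c j) (a j) (b j)) (rect (c i) (a i) (b i))) ∧
  (∀ i j : Fin k, s ≤ (i : ℕ) → s ≤ (j : ℕ) → i ≠ j →
    NonInteracting (rect (c i) (a i) (b i)) (rect (c j) (a j) (b j))) ∧
  (∀ x, (∀ i, x ∉ rect (c i) (a i) (b i)) → σ x = false) ∧
  (∀ i : Fin k, s ≤ (i : ℕ) → ∀ x ∈ rect (c i) (a i) (b i), σ x = true) ∧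
  ∃ Cp : Fin k → Config L,
    (∀ j : Fin k, (j : ℕ) < s → IsChessCfg (Cp j) ∧
      ∃ (k' : ℕ) (c' : Fin k' → Site L) (a' b' : Fin k' → ℕ),
        (∀ i, rect (c' i) (a' i) (b' i) ⊆ rect (c j) (a j) (b j)) ∧
        (∀ i i', i ≠ i' →
          NonInteracting (rect (c' i) (a' i) (b' i)) (rect (c' i') (a' i') (b' i'))) ∧
        (∀ i, ∀ x ∈ rect (c' i) (a' i) (b' i), σ x = true) ∧
        (∀ x ∈ rect (c j) (a j) (b j),
          (∀ i, x ∉ rect (c' i) (a' i) (b' i)) → σ x = Cp j x)) ∧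
    (∀ i j : Fin k, (i : ℕ) < s → (j : ℕ) < s → i ≠ j → Cp i = Cp j →
      NonInteracting (rect (c i) (a i) (b i)) (rect (c j) (a j) (b j)))

/-- `η ∈ 𝒪_{-1}` (a `(λ-1) × λ` chessboard droplet in the sea of minuses) and
`ζ ∈ π_{-1}(η)` is one of its protocritical droplets. -/
def ProtoRel (h : ℝ) (η ζ : Config L) : Prop :=
  ∃ (c : Site L) (a b : ℕ) (C : Config L) (y z : Site L),
    IsChessCfg C ∧
    ((a = lam h - 1 ∧ b = lam h) ∨ (a = lam h ∧ b = lam h - 1)) ∧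
    (∀ x ∈ rect c a b, η x = C x) ∧ (∀ x ∉ rect c a b, η x = false) ∧
    y ∉ rect c a b ∧ z ∈ rect c a b ∧ Adj y z ∧ C z = true ∧
    (∀ x ∈ rect c a b, ζ x = !(C x)) ∧ ζ y = true ∧
    (∀ x, x ∉ rect c a b → x ≠ y → ζ x = false)

/-- The set `𝒪_{-1}` of `(λ-1) × λ` chessboard droplets in the sea of minuses. -/
def OSet (h : ℝ) (L : ℕ) : Set (Config L) :=
  { η | ∃ (c : Site L) (a b : ℕ) (C : Config L),
      IsChessCfg C ∧ ((a = lam h - 1 ∧ b = lam h) ∨ (a = lam h ∧ b = lam h - 1)) ∧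
      (∀ x ∈ rect c a b, η x = C x) ∧ (∀ x ∉ rect c a b, η x = false) }

/-- The set `𝒫_{-1}` of protocritical droplets. -/
def ProtoSet (h : ℝ) (L : ℕ) : Set (Config L) := { ζ | ∃ η, ProtoRel h η ζ }

end

section ReversibleChain

variable {V : Type*} [Fintype V]

/-- The averaging operator `f ↦ P f` of a kernel `P` on a finite set. -/
def stepOp (P : V → V → ℝ) (f : V → ℝ) : V → ℝ := fun u => ∑ v, P u v * f v

/-- `f` evaluated at time `n`, as a function of the starting point. -/
def evalAt (P : V → V → ℝ) (n : ℕ) (f : V → ℝ) : V → ℝ := (stepOp P)^[n] f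

/-- The indicator function of a set. -/
noncomputable def ind {U : Type*} (A : Set U) : U → ℝ := fun u => if u ∈ A then 1 else 0

/-- The probability of not visiting `D` up to time `n` included. -/
noncomputable def surv (P : V → V → ℝ) (D : Set V) : ℕ → V → ℝ
  | 0 => ind Dᶜ
  | n + 1 => fun u => ind Dᶜ u * stepOp P (surv P D n) u

/-- The expected number of visits to `y` before time `n` for the chain killed in `A`. -/
noncomputable def green (P : V → V → ℝ) (A : Set V) (y : V) : ℕ → V → ℝ
  | 0 => fun _ => 0
  | n + 1 => fun u => ind Aᶜ u * (ind {y} u + stepOp P (green P A y n) u)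

lemma surv_succ (P : V → V → ℝ) (D : Set V) (n : ℕ) (u : V) :
    surv P D (n + 1) u = ind Dᶜ u * stepOp P (surv P D n) u := rfl

lemma green_succ (P : V → V → ℝ) (A : Set V) (y : V) (n : ℕ) (u : V) :
    green P A y (n + 1) u = ind Aᶜ u * (ind {y} u + stepOp P (green P A y n) u) := rfl

/-- A kernel with non-negative entries and unit row sums. -/
structure IsStochastic (P : V → V → ℝ) : Prop where
  nonneg : ∀ u v, 0 ≤ P u v
  sum_eq_one : ∀ u, ∑ v, P u v = 1

lemma ind_nonneg {U : Type*} (A : Set U) (u : U) : 0 ≤ ind A u := by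
  unfold ind; split_ifs <;> norm_num

lemma ind_le_one {U : Type*} (A : Set U) (u : U) : ind A u ≤ 1 := by
  unfold ind; split_ifs <;> norm_num

lemma ind_of_mem {U : Type*} {A : Set U} {u : U} (hu : u ∈ A) : ind A u = 1 := if_pos hu

lemma ind_of_notMem {U : Type*} {A : Set U} {u : U} (hu : u ∉ A) : ind A u = 0 := if_neg hu

lemma ind_compl {U : Type*} (A : Set U) (u : U) : ind Aᶜ u = 1 - ind A u := by
  unfold ind; by_cases hu : u ∈ A <;> simp [hu]

variable {P : V → V → ℝ}

lemma stepOp_add (f g : V → ℝ) :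
    stepOp P (fun u => f u + g u) = fun u => stepOp P f u + stepOp P g u := by
  funext u; simp [stepOp, mul_add, Finset.sum_add_distrib]

lemma stepOp_smul (a : ℝ) (f : V → ℝ) :
    stepOp P (fun u => a * f u) = fun u => a * stepOp P f u := by
  funext u; simp only [stepOp, Finset.mul_sum]; exact Finset.sum_congr rfl fun v _ => by ring

lemma stepOp_sum {ι : Type*} (s : Finset ι) (f : ι → V → ℝ) (u : V) :
    stepOp P (fun v => ∑ i ∈ s, f i v) u = ∑ i ∈ s, stepOp P (f i) u := by
  simp only [stepOp, Finset.mul_sum]; exact Finset.sum_comm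

namespace IsStochastic

variable (hP : IsStochastic P)
include hP

lemma stepOp_mono {f g : V → ℝ} (hfg : ∀ u, f u ≤ g u) (u : V) : stepOp P f u ≤ stepOp P g u :=
  Finset.sum_le_sum fun v _ => mul_le_mul_of_nonneg_left (hfg v) (hP.nonneg u v)

lemma stepOp_const (a : ℝ) : stepOp P (fun _ => a) = fun _ => a := by
  funext u; simp [stepOp, ← Finset.sum_mul, hP.sum_eq_one]

lemma stepOp_nonneg {f : V → ℝ} (hf : ∀ u, 0 ≤ f u) (u : V) : 0 ≤ stepOp P f u :=
  Finset.sum_nonneg fun v _ => mul_nonneg (hP.nonneg u v) (hf v)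

end IsStochastic

lemma evalAt_succ (n : ℕ) (f : V → ℝ) : evalAt P (n + 1) f = stepOp P (evalAt P n f) := by
  simp [evalAt, Function.iterate_succ_apply']

lemma evalAt_zero (f : V → ℝ) : evalAt P 0 f = f := rfl

lemma evalAt_add_time (m n : ℕ) (f : V → ℝ) :
    evalAt P (m + n) f = evalAt P m (evalAt P n f) := by
  simp [evalAt, Function.iterate_add_apply]

lemma evalAt_add (n : ℕ) (f g : V → ℝ) :
    evalAt P n (fun u => f u + g u) = fun u => evalAt P n f u + evalAt P n g u := by
  induction n with
  | zero => rfl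
  | succ n ih => rw [evalAt_succ, ih, stepOp_add]; simp [evalAt_succ]

lemma evalAt_smul (n : ℕ) (a : ℝ) (f : V → ℝ) :
    evalAt P n (fun u => a * f u) = fun u => a * evalAt P n f u := by
  induction n with
  | zero => rfl
  | succ n ih => rw [evalAt_succ, ih, stepOp_smul]; simp [evalAt_succ]

namespace IsStochastic

variable (hP : IsStochastic P)
include hP

lemma evalAt_mono (n : ℕ) {f g : V → ℝ} (hfg : ∀ u, f u ≤ g u) (u : V) :
    evalAt P n f u ≤ evalAt P n g u := by
  induction n generalizing u with
  | zero => exact hfg u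
  | succ n ih => rw [evalAt_succ, evalAt_succ]; exact hP.stepOp_mono ih u

lemma evalAt_const (n : ℕ) (a : ℝ) : evalAt P n (fun _ => a) = fun _ => a := by
  induction n with
  | zero => rfl
  | succ n ih => rw [evalAt_succ, ih, hP.stepOp_const]

lemma evalAt_nonneg (n : ℕ) {f : V → ℝ} (hf : ∀ u, 0 ≤ f u) (u : V) : 0 ≤ evalAt P n f u := by
  have := hP.evalAt_mono n (f := fun _ => 0) hf u
  rwa [hP.evalAt_const] at this

lemma evalAt_le (n : ℕ) {f : V → ℝ} {a : ℝ} (hf : ∀ u, f u ≤ a) (u : V) : evalAt P n f u ≤ a := by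
  have := hP.evalAt_mono n (g := fun _ => a) hf u
  rwa [hP.evalAt_const] at this

lemma evalAt_ind_le_one (n : ℕ) (A : Set V) (u : V) : evalAt P n (ind A) u ≤ 1 :=
  hP.evalAt_le n (ind_le_one A) u

lemma evalAt_ind_compl (n : ℕ) (A : Set V) (u : V) :
    evalAt P n (ind Aᶜ) u = 1 - evalAt P n (ind A) u := by
  have h1 : (fun u => ind A u + ind Aᶜ u) = fun _ : V => (1 : ℝ) := by
    funext u; rw [ind_compl]; ring
  have h2 := congrFun (evalAt_add (P := P) n (ind A) (ind Aᶜ)) u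
  rw [h1, hP.evalAt_const] at h2
  linarith

lemma surv_nonneg (D : Set V) (n : ℕ) (u : V) : 0 ≤ surv P D n u := by
  induction n generalizing u with
  | zero => exact ind_nonneg _ _
  | succ n ih => exact mul_nonneg (ind_nonneg _ _) (hP.stepOp_nonneg ih u)

lemma surv_le_one (D : Set V) (n : ℕ) (u : V) : surv P D n u ≤ 1 := by
  induction n generalizing u with
  | zero => exact ind_le_one _ _
  | succ n ih =>
    refine mul_le_one₀ (ind_le_one _ _) (hP.stepOp_nonneg (hP.surv_nonneg D n) u) ?_
    have := hP.stepOp_mono ih u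
    rwa [hP.stepOp_const] at this

omit hP in
lemma surv_of_mem {D : Set V} {u : V} (hu : u ∈ D) (n : ℕ) : surv P D n u = 0 := by
  have h0 : ind Dᶜ u = 0 := ind_of_notMem (by simpa using hu)
  cases n <;> simp [surv, h0]

lemma surv_anti_set {D E : Set V} (hDE : D ⊆ E) (n : ℕ) (u : V) :
    surv P E n u ≤ surv P D n u := by
  have hi : ∀ u, ind Eᶜ u ≤ ind Dᶜ u := by
    intro u
    by_cases hu : u ∈ E
    · rw [ind_of_notMem (by simpa using hu)]; exact ind_nonneg _ _
    · rw [ind_of_mem (A := Dᶜ) (fun h => hu (hDE h))]; exact ind_le_one _ _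
  induction n generalizing u with
  | zero => exact hi u
  | succ n ih =>
    exact mul_le_mul (hi u) (hP.stepOp_mono ih u) (hP.stepOp_nonneg (hP.surv_nonneg E n) u)
      (ind_nonneg _ _)

lemma surv_succ_le_stepOp (D : Set V) (n : ℕ) (u : V) :
    surv P D (n + 1) u ≤ stepOp P (surv P D n) u := by
  have := mul_le_mul_of_nonneg_right (ind_le_one Dᶜ u)
    (hP.stepOp_nonneg (hP.surv_nonneg D n) u)
  simpa [surv] using this

lemma surv_add_le (D : Set V) (m n : ℕ) (u : V) :
    surv P D (m + n) u ≤ evalAt P m (surv P D n) u := by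
  induction m generalizing u with
  | zero => simp [evalAt]
  | succ m ih =>
    rw [Nat.succ_add, evalAt_succ]
    exact (hP.surv_succ_le_stepOp D (m + n) u).trans (hP.stepOp_mono ih u)

lemma surv_antitone (D : Set V) (u : V) : Antitone fun n => surv P D n u := by
  have h : ∀ n u, surv P D (n + 1) u ≤ surv P D n u := by
    intro n
    induction n with
    | zero =>
      intro u
      have := mul_le_mul_of_nonneg_left (hP.stepOp_mono (hP.surv_le_one D 0) u)
        (ind_nonneg Dᶜ u)
      rw [hP.stepOp_const, mul_one] at this
      exact this
    | succ n ih =>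
      intro u
      exact mul_le_mul_of_nonneg_left (hP.stepOp_mono ih u) (ind_nonneg _ _)
  exact antitone_nat_of_succ_le fun n => h n u

lemma surv_le_evalAt (D : Set V) (n : ℕ) (u : V) :
    surv P D n u ≤ evalAt P n (ind Dᶜ) u :=
  hP.surv_add_le D n 0 u

/-- If the chain started in `B` is found outside `B` with probability at most `r`, then so it is
from everywhere, up to the probability of not having visited `B`. -/
lemma evalAt_ind_compl_le_surv_add {B : Set V} {r : ℝ} {t : ℕ}
    (hr : ∀ b ∈ B, ∀ s ≤ t, evalAt P s (ind Bᶜ) b ≤ r) (hr0 : 0 ≤ r) (u : V) :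
    evalAt P t (ind Bᶜ) u ≤ surv P B t u + r := by
  induction t generalizing u with
  | zero => simp [evalAt, surv, hr0]
  | succ t ih =>
    by_cases hu : u ∈ B
    · exact (hr u hu _ le_rfl).trans (by linarith [hP.surv_nonneg B (t + 1) u])
    · have h1 := hP.stepOp_mono (ih fun b hb s hs => hr b hb s (by omega)) u
      rw [stepOp_add, hP.stepOp_const] at h1
      rw [evalAt_succ, surv_succ, ind_of_mem (A := Bᶜ) hu, one_mul]
      exact h1

/-- Union bound on the time of the first entrance in `W`. -/
lemma one_sub_surv_le_sum (W : Set V) (t : ℕ) (u : V) :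
    1 - surv P W t u ≤ ind W u +
      ∑ n ∈ Finset.range t, evalAt P n (fun v => ind Wᶜ v * stepOp P (ind W) v) u := by
  have hg : ∀ v, 0 ≤ ind Wᶜ v * stepOp P (ind W) v := fun v =>
    mul_nonneg (ind_nonneg _ _) (hP.stepOp_nonneg (ind_nonneg W) v)
  induction t generalizing u with
  | zero => simp [surv, ind_compl]
  | succ t ih =>
    by_cases hu : u ∈ W
    · have := hP.surv_nonneg W (t + 1) u
      have h2 : 0 ≤ ∑ n ∈ Finset.range (t + 1),
          evalAt P n (fun v => ind Wᶜ v * stepOp P (ind W) v) u :=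
        Finset.sum_nonneg fun n _ => hP.evalAt_nonneg n hg u
      rw [ind_of_mem hu]; linarith
    · have h1 := hP.stepOp_mono ih u
      rw [stepOp_add] at h1
      beta_reduce at h1
      rw [stepOp_sum] at h1
      have h2 : stepOp P (fun v => 1 - surv P W t v) u = 1 - stepOp P (surv P W t) u := by
        have := congrFun (stepOp_add (P := P) (fun v => 1 - surv P W t v) (surv P W t)) u
        simp only [sub_add_cancel, hP.stepOp_const] at this
        linarith
      rw [h2] at h1
      rw [Finset.sum_range_succ', surv_succ, ind_of_mem (A := Wᶜ) hu, ind_of_notMem hu, one_mul]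
      simp only [evalAt_succ, evalAt_zero, ind_of_mem (A := Wᶜ) hu, one_mul]
      linarith

lemma green_nonneg (A : Set V) (y : V) (n : ℕ) (u : V) : 0 ≤ green P A y n u := by
  induction n generalizing u with
  | zero => exact le_rfl
  | succ n ih =>
    exact mul_nonneg (ind_nonneg _ _) (add_nonneg (ind_nonneg _ _) (hP.stepOp_nonneg ih u))

lemma green_le_succ (A : Set V) (y : V) (n : ℕ) (u : V) :
    green P A y n u ≤ green P A y (n + 1) u := by
  induction n generalizing u with
  | zero => exact hP.green_nonneg A y 1 u
  | succ n ih =>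
    exact mul_le_mul_of_nonneg_left (by linarith [hP.stepOp_mono ih u]) (ind_nonneg _ _)

omit hP in
lemma green_of_mem {A : Set V} {u : V} (hu : u ∈ A) (y : V) (n : ℕ) : green P A y n u = 0 := by
  have h0 : ind Aᶜ u = 0 := ind_of_notMem (by simpa using hu)
  cases n <;> simp [green, h0]

lemma green_le_diag (A : Set V) (y : V) (n : ℕ) (u : V) :
    green P A y n u ≤ green P A y n y := by
  induction n generalizing u with
  | zero => exact le_rfl
  | succ n ih =>
    by_cases huy : u = y
    · rw [huy]
    · have h1 := hP.stepOp_mono ih u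
      rw [hP.stepOp_const] at h1
      have h2 : ind {y} u = 0 := ind_of_notMem (by simpa using huy)
      calc green P A y (n + 1) u = ind Aᶜ u * stepOp P (green P A y n) u := by
            simp [green, h2]
        _ ≤ 1 * stepOp P (green P A y n) u :=
            mul_le_mul_of_nonneg_right (ind_le_one _ _)
              (hP.stepOp_nonneg (hP.green_nonneg A y n) u)
        _ ≤ green P A y n y := by rw [one_mul]; exact h1
        _ ≤ green P A y (n + 1) y := hP.green_le_succ A y n y

omit hP in
lemma sum_surv_eq_sum_green (A : Set V) (n : ℕ) (u : V) :
    ∑ s ∈ Finset.range n, surv P A s u = ∑ y, green P A y n u := by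
  induction n generalizing u with
  | zero => simp [green]
  | succ n ih =>
    rw [Finset.sum_range_succ']
    simp only [surv, green]
    rw [← Finset.mul_sum, ← Finset.mul_sum, Finset.sum_add_distrib, ← stepOp_sum, ← stepOp_sum]
    have h1 : ∑ y, ind {y} u = 1 := by
      simp [ind]
    rw [h1, funext ih]
    ring

end IsStochastic

/-- A stochastic kernel satisfying detailed balance with respect to a positive weight `ν`. -/
structure IsReversible (P : V → V → ℝ) (ν : V → ℝ) : Prop extends IsStochastic P where
  pos : ∀ u, 0 < ν u
  balance : ∀ u v, ν u * P u v = ν v * P v u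

namespace IsReversible

variable {ν : V → ℝ} (hR : IsReversible P ν)
include hR

lemma sum_weight_mul_stepOp (f : V → ℝ) : ∑ u, ν u * stepOp P f u = ∑ u, ν u * f u := by
  simp only [stepOp, Finset.mul_sum]
  rw [Finset.sum_comm]
  refine Finset.sum_congr rfl fun v _ => ?_
  have : ∀ u, ν u * (P u v * f v) = P v u * (ν v * f v) := fun u => by
    rw [← mul_assoc, hR.balance]; ring
  simp only [this]
  rw [← Finset.sum_mul, hR.sum_eq_one, one_mul]

lemma sum_weight_mul_evalAt (n : ℕ) (f : V → ℝ) :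
    ∑ u, ν u * evalAt P n f u = ∑ u, ν u * f u := by
  induction n with
  | zero => rfl
  | succ n ih => rw [evalAt_succ, hR.sum_weight_mul_stepOp, ih]

lemma weight_mul_evalAt_le (n : ℕ) {f : V → ℝ} (hf : ∀ u, 0 ≤ f u) (u : V) :
    ν u * evalAt P n f u ≤ ∑ v, ν v * f v := by
  rw [← hR.sum_weight_mul_evalAt n f]
  exact Finset.single_le_sum (f := fun v => ν v * evalAt P n f v)
    (fun v _ => mul_nonneg (hR.pos v).le (hR.evalAt_nonneg n hf v)) (Finset.mem_univ u)

/-- The entrance time in `W` is at least of the order of the inverse conductance of the cut. -/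
lemma one_sub_surv_le {W : Set V} {u : V} (hu : u ∉ W) {κ : ℝ}
    (hκ : ∀ v ∉ W, ∀ w ∈ W, ν v * P v w ≤ κ * ν u) (hκ0 : 0 ≤ κ) (t : ℕ) :
    1 - surv P W t u ≤ t * ((Fintype.card V : ℝ) ^ 2 * κ) := by
  have hg : ∀ v, 0 ≤ ind Wᶜ v * stepOp P (ind W) v := fun v =>
    mul_nonneg (ind_nonneg _ _) (hR.stepOp_nonneg (ind_nonneg W) v)
  have hflow : ∑ v, ν v * (ind Wᶜ v * stepOp P (ind W) v) ≤
      (Fintype.card V : ℝ) ^ 2 * κ * ν u := by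
    have : ∀ v, ν v * (ind Wᶜ v * stepOp P (ind W) v) ≤ ∑ _w : V, κ * ν u := by
      intro v
      simp only [stepOp, Finset.mul_sum]
      refine Finset.sum_le_sum fun w _ => ?_
      have h0 : 0 ≤ κ * ν u := mul_nonneg hκ0 (hR.pos u).le
      by_cases hv : v ∈ W
      · rw [ind_of_notMem (A := Wᶜ) (by simpa using hv)]; simpa using h0
      by_cases hw : w ∈ W
      · rw [ind_of_mem (A := Wᶜ) hv, ind_of_mem hw]
        simpa using hκ v hv w hw
      · rw [ind_of_notMem hw]; simpa using h0
    calc _ ≤ ∑ _v : V, ∑ _w : V, κ * ν u := Finset.sum_le_sum fun v _ => this v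
      _ = _ := by simp; ring
  have hn : ∀ n, evalAt P n (fun v => ind Wᶜ v * stepOp P (ind W) v) u ≤
      (Fintype.card V : ℝ) ^ 2 * κ := by
    intro n
    have h1 := (hR.weight_mul_evalAt_le n hg u).trans hflow
    rw [mul_comm (ν u)] at h1
    exact le_of_mul_le_mul_right h1 (hR.pos u)
  have := hR.one_sub_surv_le_sum W t u
  rw [ind_of_notMem hu, zero_add] at this
  refine this.trans ((Finset.sum_le_sum fun n _ => hn n).trans ?_)
  simp

lemma dirichlet_eq (f : V → ℝ) :
    ∑ x, ∑ z, ν x * P x z * (f x - f z) ^ 2 = 2 * ∑ x, ν x * (f x * (f x - stepOp P f x)) := by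
  have e1 : ∀ x z, ν x * P x z * (f x - f z) ^ 2 =
      ν x * (P x z * (f x) ^ 2) + ν x * (P x z * (f z) ^ 2) -
        2 * (ν x * (f x * (P x z * f z))) := by
    intro x z; ring
  have e2 : ∀ x, ∑ z, ν x * P x z * (f x - f z) ^ 2 =
      ν x * (f x) ^ 2 + ν x * stepOp P (fun z => (f z) ^ 2) x -
        2 * (ν x * (f x * stepOp P f x)) := by
    intro x
    simp only [e1, Finset.sum_sub_distrib, Finset.sum_add_distrib, ← Finset.mul_sum,
      ← Finset.sum_mul, hR.sum_eq_one, one_mul, stepOp]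
  simp only [e2, Finset.sum_sub_distrib, Finset.sum_add_distrib, hR.sum_weight_mul_stepOp]
  simp only [← Finset.mul_sum, mul_sub, Finset.sum_sub_distrib]
  have : ∀ x, ν x * (f x * f x) = ν x * (f x) ^ 2 := fun x => by ring
  simp only [this]
  ring

lemma green_diag_le {A : Set V} {y : V} {ℓ κ : ℝ} (hκ : 0 < κ)
    (hpath : ∀ (f : V → ℝ) (d : ℝ), 0 ≤ d → (∀ x z, κ ≤ ν x * P x z → |f x - f z| ≤ d) →
      ∃ a ∈ A, |f y - f a| ≤ ℓ * d) (n : ℕ) :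
    green P A y n y ≤ 2 * ℓ ^ 2 * (ν y / κ) := by
  set f := green P A y n with hf
  have hf0 : ∀ u, 0 ≤ f u := hR.green_nonneg A y n
  have hdir : ∑ x, ∑ z, ν x * P x z * (f x - f z) ^ 2 ≤ 2 * (ν y * f y) := by
    rw [hR.dirichlet_eq]
    have h1 : ∀ x, ν x * (f x * (f x - stepOp P f x)) ≤ if x = y then ν y * f y else 0 := by
      intro x
      by_cases hx : x ∈ A
      · have : f x = 0 := IsStochastic.green_of_mem hx y n
        rw [this]; split_ifs
        · simpa using mul_nonneg (hR.pos y).le (hf0 y)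
        · simp
      · have hs := hR.green_le_succ A y n x
        rw [green_succ, ind_of_mem (A := Aᶜ) hx, one_mul, ← hf] at hs
        by_cases hxy : x = y
        · subst hxy
          rw [if_pos rfl]
          rw [ind_of_mem (by simp)] at hs
          exact mul_le_mul_of_nonneg_left
            (by nlinarith [hf0 x]) (hR.pos x).le
        · rw [if_neg hxy]
          rw [ind_of_notMem (by simpa using hxy)] at hs
          exact mul_nonpos_of_nonneg_of_nonpos (hR.pos x).le
            (mul_nonpos_of_nonneg_of_nonpos (hf0 x) (by linarith))
    have := Finset.sum_le_sum fun x (_ : x ∈ Finset.univ) => h1 x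
    rw [Finset.sum_ite_eq' Finset.univ y fun _ => ν y * f y] at this
    simp only [Finset.mem_univ, if_true] at this
    linarith
  have hedge : ∀ x z, κ ≤ ν x * P x z → |f x - f z| ≤ Real.sqrt (2 * (ν y * f y) / κ) := by
    intro x z hxz
    refine Real.abs_le_sqrt ?_
    rw [le_div_iff₀ hκ]
    have hnn : ∀ x z, 0 ≤ ν x * P x z * (f x - f z) ^ 2 := fun x z =>
      mul_nonneg (mul_nonneg (hR.pos x).le (hR.nonneg x z)) (sq_nonneg _)
    calc (f x - f z) ^ 2 * κ ≤ ν x * P x z * (f x - f z) ^ 2 := by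
          rw [mul_comm]; exact mul_le_mul_of_nonneg_right hxz (sq_nonneg _)
      _ ≤ ∑ z, ν x * P x z * (f x - f z) ^ 2 :=
          Finset.single_le_sum (f := fun z => ν x * P x z * (f x - f z) ^ 2)
            (fun z _ => hnn x z) (Finset.mem_univ z)
      _ ≤ ∑ x, ∑ z, ν x * P x z * (f x - f z) ^ 2 :=
          Finset.single_le_sum (f := fun x => ∑ z, ν x * P x z * (f x - f z) ^ 2)
            (fun x _ => Finset.sum_nonneg fun z _ => hnn x z) (Finset.mem_univ x)
      _ ≤ _ := hdir
  obtain ⟨a, ha, hya⟩ := hpath f _ (Real.sqrt_nonneg _) hedge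
  rw [show f a = 0 from IsStochastic.green_of_mem ha y n, sub_zero, abs_of_nonneg (hf0 y)] at hya
  have hsq : f y ^ 2 ≤ ℓ ^ 2 * (2 * (ν y * f y) / κ) := by
    have h2 := pow_le_pow_left₀ (hf0 y) hya 2
    rwa [mul_pow, Real.sq_sqrt (div_nonneg (by have := mul_nonneg (hR.pos y).le (hf0 y); linarith)
      hκ.le)] at h2
  rcases (hf0 y).eq_or_lt with h0 | h0
  · rw [← h0]; have := (hR.pos y).le; positivity
  · have : f y * f y ≤ (2 * ℓ ^ 2 * (ν y / κ)) * f y := by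
      calc f y * f y = f y ^ 2 := by ring
        _ ≤ _ := hsq
        _ = _ := by ring
    exact le_of_mul_le_mul_right this h0

/-- Upper bound on the hitting time of `A`, through paths of large conductance. -/
lemma mul_surv_le {A : Set V} {ℓ M : ℝ} {κ : V → ℝ} (hκ : ∀ y, 0 < κ y)
    (hpath : ∀ (y : V) (f : V → ℝ) (d : ℝ), 0 ≤ d →
      (∀ x z, κ y ≤ ν x * P x z → |f x - f z| ≤ d) → ∃ a ∈ A, |f y - f a| ≤ ℓ * d)
    (hM : ∀ y, ν y ≤ M * κ y) (n : ℕ) (u : V) :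
    n * surv P A n u ≤ 2 * ℓ ^ 2 * Fintype.card V * M := by
  calc n * surv P A n u = ∑ s ∈ Finset.range n, surv P A n u := by simp
    _ ≤ ∑ s ∈ Finset.range n, surv P A s u :=
        Finset.sum_le_sum fun s hs => hR.surv_antitone A u (Finset.mem_range.1 hs).le
    _ = ∑ y, green P A y n u := IsStochastic.sum_surv_eq_sum_green A n u
    _ ≤ ∑ _y : V, 2 * ℓ ^ 2 * M := by
        refine Finset.sum_le_sum fun y _ => (hR.green_le_diag A y n u).trans
          ((hR.green_diag_le (hκ y) (hpath y) n).trans ?_)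
        exact mul_le_mul_of_nonneg_left ((div_le_iff₀ (hκ y)).2 (hM y)) (by positivity)
    _ = _ := by simp; ring

end IsReversible

end ReversibleChain

section Sublattices

variable {L : ℕ}

/-- A spin configuration on one of the two sublattices of the torus; the sublattice of parity `b`
is the set of sites at which `chessE L` takes the value `b`. -/
abbrev Half (L : ℕ) := Σ b : Bool, ({x : Site L // chessE L x = b} → Bool)

/-- Restriction of a configuration to the sublattice of parity `b`. -/
def res (b : Bool) (σ : Config L) : Half L := ⟨b, fun x => σ x.1⟩

/-- Extension of a sublattice configuration by minus spins. -/
def ext (v : Half L) : Config L := fun x => if hx : chessE L x = v.1 then v.2 ⟨x, hx⟩ else false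

lemma ext_res {b : Bool} {σ : Config L} {x : Site L} (hx : chessE L x = b) :
    ext (res b σ) x = σ x := by
  simp [ext, res, hx]

lemma res_eq_res_iff {b : Bool} {σ η : Config L} :
    res b σ = res b η ↔ ∀ x, chessE L x = b → σ x = η x := by
  constructor
  · intro h x hx
    rw [← ext_res (σ := σ) hx, h, ext_res hx]
  · intro h
    unfold res
    congr 1
    funext x
    exact h x.1 x.2

lemma res_ext (v : Half L) : res v.1 (ext v) = v := by
  obtain ⟨b, f⟩ := v
  unfold res ext
  congr 1
  funext x
  simp [x.2]

/-- Configurations restricting to given configurations of the two sublattices. -/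
lemma exists_res_eq {v w : Half L} (hvw : w.1 = !v.1) :
    ∃ σ : Config L, v = res v.1 σ ∧ w = res (!v.1) σ := by
  refine ⟨fun x => if chessE L x = v.1 then ext v x else ext w x, ?_, ?_⟩
  · conv_lhs => rw [← res_ext v]
    exact res_eq_res_iff.2 fun x hx => by simp [hx]
  · conv_lhs => rw [← res_ext w, hvw]
    exact res_eq_res_iff.2 fun x hx => by simp [hx]

lemma eq_of_res_eq {σ η : Config L} {b : Bool} (h1 : res b σ = res b η)
    (h2 : res (!b) σ = res (!b) η) : σ = η := by
  funext x
  by_cases hx : chessE L x = b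
  · exact res_eq_res_iff.1 h1 x hx
  · exact res_eq_res_iff.1 h2 x (by revert hx; cases chessE L x <;> cases b <;> simp)

section Parity

variable [NeZero L] (hL : Even L)
include hL

lemma val_add_one_mod_two (a : ZMod L) : (a + 1).val % 2 = (a.val + 1) % 2 := by
  have h2 : 2 ∣ L := hL.two_dvd
  rw [ZMod.val_add, ZMod.val_one_eq_one_mod, Nat.mod_mod_of_dvd _ h2, Nat.add_mod,
    Nat.mod_mod_of_dvd _ h2, ← Nat.add_mod]

lemma chessE_add_east (x : Site L) : chessE L (x + east L) = !chessE L x := by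
  have := val_add_one_mod_two hL (x.1 + x.2)
  have h2 : (x + east L).1 + (x + east L).2 = x.1 + x.2 + 1 := by
    simp [east]; ring
  unfold chessE
  rw [h2]
  rcases Nat.mod_two_eq_zero_or_one (x.1 + x.2).val with h | h
  · have : (x.1 + x.2 + 1).val % 2 = 1 := by omega
    simp [h, this]
  · have : (x.1 + x.2 + 1).val % 2 = 0 := by omega
    simp [h, this]

lemma chessE_add_north (x : Site L) : chessE L (x + north L) = !chessE L x := by
  have h2 : (x + north L).1 + (x + north L).2 = (x + east L).1 + (x + east L).2 := by
    simp [east, north]; ring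
  rw [← chessE_add_east hL x]
  unfold chessE
  rw [h2]

lemma chessE_sub_east (x : Site L) : chessE L (x - east L) = !chessE L x := by
  have := chessE_add_east hL (x - east L)
  rw [sub_add_cancel] at this
  rw [this, Bool.not_not]

lemma chessE_sub_north (x : Site L) : chessE L (x - north L) = !chessE L x := by
  have := chessE_add_north hL (x - north L)
  rw [sub_add_cancel] at this
  rw [this, Bool.not_not]

/-- The sum of the neighbouring spins of `x` only depends on the sublattice not containing `x`. -/
lemma nnS_ext_res (σ : Config L) {b : Bool} {x : Site L} (hx : chessE L x = !b) :
    nnS (ext (res b σ)) x = nnS σ x := by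
  have hb : (!chessE L x) = b := by rw [hx, Bool.not_not]
  unfold nnS
  rw [ext_res ((chessE_add_east hL x).trans hb), ext_res ((chessE_sub_east hL x).trans hb),
    ext_res ((chessE_add_north hL x).trans hb), ext_res ((chessE_sub_north hL x).trans hb)]

end Parity

variable [NeZero L]

/-- The transition kernel of one of the two independent components of the chain: the spins of the
two sublattices are updated alternately. -/
noncomputable def copyP (β h : ℝ) (v w : Half L) : ℝ :=
  if w.1 = !v.1 then ∏ x : {x : Site L // chessE L x = w.1}, flipP β h (ext v) x.1 (w.2 x) else 0

lemma copyP_res (hL : Even L) (β h : ℝ) (b : Bool) (σ η : Config L) :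
    copyP β h (res b σ) (res (!b) η) =
      ∏ x : {x : Site L // chessE L x = !b}, flipP β h σ x.1 (η x.1) := by
  rw [copyP, if_pos (show (res (!b) η).1 = !(res b σ).1 from rfl)]
  refine Finset.prod_congr rfl fun x _ => ?_
  unfold flipP
  rw [nnS_ext_res hL σ x.2]
  rfl

lemma Pmat_eq_copyP_mul_copyP (hL : Even L) (β h : ℝ) (σ η : Config L) :
    Pmat β h σ η =
      copyP β h (res false σ) (res true η) * copyP β h (res true σ) (res false η) := by
  have h1 := copyP_res hL β h false σ η
  have h2 := copyP_res hL β h true σ η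
  simp only [Bool.not_false, Bool.not_true] at h1 h2
  rw [h1, h2, Pmat, ← Fintype.prod_fiberwise (chessE L), Fintype.prod_bool]
  congr!

omit [NeZero L] in
lemma flipP_pos (β h : ℝ) (σ : Config L) (x : Site L) (a : Bool) : 0 < flipP β h σ x a := by
  unfold flipP; positivity

omit [NeZero L] in
lemma flipP_eq (β h : ℝ) (σ : Config L) (x : Site L) (a : Bool) :
    flipP β h σ x a = Real.exp (β * (spin a * (nnS σ x + h))) /
      (2 * Real.cosh (β * (nnS σ x + h))) := by
  set t := nnS σ x + h with ht
  have e1 := Real.exp_pos (β * t)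
  have e2 := Real.exp_pos (-(β * t))
  have hcosh : 2 * Real.cosh (β * t) = Real.exp (β * t) + Real.exp (-(β * t)) := by
    rw [Real.cosh_eq]; ring
  unfold flipP
  rw [hcosh, ← ht]
  cases a
  · have : Real.exp (-2 * β * spin false * t) = Real.exp (β * t) * Real.exp (β * t) := by
      rw [← Real.exp_add]; congr 1; simp [spin]; ring
    have h2 : Real.exp (β * (spin false * t)) = Real.exp (-(β * t)) := by
      congr 1; simp [spin]
    have h3 : Real.exp (β * t) * Real.exp (-(β * t)) = 1 := by
      rw [← Real.exp_add]; simp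
    rw [this, h2, div_eq_div_iff (by positivity) (by positivity)]
    nlinarith
  · have : Real.exp (-2 * β * spin true * t) = Real.exp (-(β * t)) * Real.exp (-(β * t)) := by
      rw [← Real.exp_add]; congr 1; simp [spin]; ring
    have h2 : Real.exp (β * (spin true * t)) = Real.exp (β * t) := by
      congr 1; simp [spin]
    have h3 : Real.exp (β * t) * Real.exp (-(β * t)) = 1 := by
      rw [← Real.exp_add]; simp
    rw [this, h2, div_eq_div_iff (by positivity) (by positivity)]
    nlinarith

omit [NeZero L] in
lemma flipP_sum (β h : ℝ) (σ : Config L) (x : Site L) : ∑ a, flipP β h σ x a = 1 := by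
  rw [Fintype.sum_bool, flipP_eq, flipP_eq, ← add_div, Real.cosh_eq]
  have e1 := Real.exp_pos (β * (nnS σ x + h))
  have e2 := Real.exp_pos (-(β * (nnS σ x + h)))
  rw [div_eq_one_iff_eq (by positivity)]
  simp [spin]
  ring_nf

lemma sum_copyP_mul (β h : ℝ) (v : Half L) (f : Half L → ℝ) :
    ∑ w, copyP β h v w * f w =
      ∑ a : {x : Site L // chessE L x = !v.1} → Bool,
        copyP β h v ⟨!v.1, a⟩ * f ⟨!v.1, a⟩ := by
  rw [Fintype.sum_sigma]
  refine Fintype.sum_eq_single (!v.1) fun b hb => ?_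
  refine Finset.sum_eq_zero fun a _ => ?_
  rw [copyP, if_neg hb, zero_mul]

lemma isStochastic_copyP (β h : ℝ) : IsStochastic (copyP β h : Half L → Half L → ℝ) := by
  constructor
  · intro v w
    unfold copyP
    split_ifs
    · exact Finset.prod_nonneg fun x _ => (flipP_pos _ _ _ _ _).le
    · exact le_rfl
  · intro v
    have h1 := sum_copyP_mul β h v fun _ => 1
    simp only [mul_one] at h1
    rw [h1]
    simp only [copyP, if_true]
    rw [← Fintype.piFinset_univ, ← Finset.prod_univ_sum]
    exact Finset.prod_eq_one fun x _ => flipP_sum _ _ _ _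

/-- A product of two functions, each of them reading one sublattice. -/
def tens (f g : Half L → ℝ) : Config L → ℝ := fun σ => f (res true σ) * g (res false σ)

/-- The two sublattices determine a configuration. -/
def splitEquiv (L : ℕ) : Config L ≃
    ({x : Site L // chessE L x = true} → Bool) × ({x : Site L // chessE L x = false} → Bool) where
  toFun σ := (fun x => σ x.1, fun x => σ x.1)
  invFun p x := if hx : chessE L x = true then p.1 ⟨x, hx⟩
    else p.2 ⟨x, Bool.eq_false_of_not_eq_true hx⟩
  left_inv σ := by funext x; simp
  right_inv p := by
    ext x
    · simp [x.2]
    · have := x.2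
      simp [x.2]

lemma stepOp_Pmat_tens (hL : Even L) (β h : ℝ) (f g : Half L → ℝ) :
    stepOp (Pmat β h) (tens f g) = tens (stepOp (copyP β h) g) (stepOp (copyP β h) f) := by
  funext σ
  have hf : stepOp (copyP β h) f (res false σ) =
      ∑ a : {x : Site L // chessE L x = true} → Bool,
        copyP β h (res false σ) ⟨true, a⟩ * f ⟨true, a⟩ := sum_copyP_mul β h (res false σ) f
  have hg : stepOp (copyP β h) g (res true σ) =
      ∑ a : {x : Site L // chessE L x = false} → Bool,
        copyP β h (res true σ) ⟨false, a⟩ * g ⟨false, a⟩ := sum_copyP_mul β h (res true σ) g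
  simp only [tens]
  rw [hf, hg, mul_comm, Finset.sum_mul_sum, ← Fintype.sum_prod_type']
  refine (splitEquiv L).sum_comp
    (fun p => copyP β h (res false σ) ⟨true, p.1⟩ * f ⟨true, p.1⟩ *
      (copyP β h (res true σ) ⟨false, p.2⟩ * g ⟨false, p.2⟩)) |>.symm.trans ?_ |>.symm
  refine Finset.sum_congr rfl fun η _ => ?_
  rw [Pmat_eq_copyP_mul_copyP hL]
  simp only [tens, res, splitEquiv, Equiv.coe_fn_mk]
  ring

lemma isStochastic_Pmat (hL : Even L) (β h : ℝ) :
    IsStochastic (Pmat β h : Config L → Config L → ℝ) := by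
  constructor
  · exact fun σ η => Finset.prod_nonneg fun x _ => (flipP_pos _ _ _ _ _).le
  · intro σ
    have h1 := congrFun (stepOp_Pmat_tens hL β h (L := L) (fun _ => 1) (fun _ => 1)) σ
    rw [(isStochastic_copyP β h).stepOp_const] at h1
    simpa [stepOp, tens] using h1

lemma evalAt_Pmat_tens (hL : Even L) (β h : ℝ) (f g : Half L → ℝ) (n : ℕ) :
    ∃ b, ∀ σ : Config L, evalAt (Pmat β h) n (tens f g) σ =
      evalAt (copyP β h) n f (res b σ) * evalAt (copyP β h) n g (res (!b) σ) := by
  have key : evalAt (Pmat β h) n (tens f g) =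
      tens (evalAt (copyP β h) n f) (evalAt (copyP β h) n g) ∨
      evalAt (Pmat β h) n (tens f g) =
      tens (evalAt (copyP β h) n g) (evalAt (copyP β h) n f) := by
    induction n with
    | zero => exact Or.inl rfl
    | succ n ih =>
      rcases ih with ih | ih
      · right; rw [evalAt_succ, ih, stepOp_Pmat_tens hL]; simp only [evalAt_succ]
      · left; rw [evalAt_succ, ih, stepOp_Pmat_tens hL]; simp only [evalAt_succ]
  rcases key with key | key
  · exact ⟨true, fun σ => by rw [key]; rfl⟩
  · exact ⟨false, fun σ => by rw [key]; exact mul_comm _ _⟩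

lemma surv_Pmat (hL : Even L) (β h : ℝ) (W : Set (Half L)) (n : ℕ) :
    surv (Pmat β h) {σ : Config L | res true σ ∈ W ∨ res false σ ∈ W} n =
      tens (surv (copyP β h) W n) (surv (copyP β h) W n) := by
  have h0 : ind {σ : Config L | res true σ ∈ W ∨ res false σ ∈ W}ᶜ = tens (ind Wᶜ) (ind Wᶜ) := by
    funext σ
    by_cases h1 : res true σ ∈ W <;> by_cases h2 : res false σ ∈ W <;> simp [ind, tens, h1, h2]
  induction n with
  | zero => exact h0
  | succ n ih =>
    funext σ
    rw [surv_succ, ih, h0, stepOp_Pmat_tens hL]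
    simp only [tens, surv_succ]
    ring

end Sublattices

section IsingWeight

variable {L : ℕ} [NeZero L]

/-- The energy of the Ising model with field `h`, normalised to vanish at the all-minus
configuration. -/
noncomputable def isingH (h : ℝ) (σ : Config L) : ℝ :=
  ∑ x : Site L, ((1 - spin (σ x) * spin (σ (x + east L))) +
    (1 - spin (σ x) * spin (σ (x + north L)))) - h * ∑ x : Site L, (1 + spin (σ x))

lemma isingH_eq (hL : Even L) (h : ℝ) (σ : Config L) (b : Bool) :
    isingH h σ = (2 - h) * Fintype.card (Site L)
      - h * ∑ x : {x : Site L // chessE L x = b}, spin (σ x.1)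
      - ∑ x : {x : Site L // chessE L x = !b}, spin (σ x.1) * (nnS σ x.1 + h) := by
  have fib : ∀ f : Site L → ℝ, ∑ x, f x = ∑ x : {x : Site L // chessE L x = b}, f x.1 +
      ∑ x : {x : Site L // chessE L x = !b}, f x.1 := by
    intro f
    rw [← Fintype.sum_fiberwise (chessE L), Fintype.sum_bool]
    cases b
    · exact add_comm _ _
    · rfl
  have shift : ∀ e : Site L, (∀ x, chessE L (x + e) = !chessE L x) →
      ∑ x : {x : Site L // chessE L x = b}, spin (σ x.1) * spin (σ (x.1 + e)) =
      ∑ x : {x : Site L // chessE L x = !b}, spin (σ x.1) * spin (σ (x.1 - e)) := by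
    intro e he
    have he' : ∀ x, chessE L x = (!b) → chessE L (x - e) = b := by
      intro x hx
      have := he (x - e)
      rw [sub_add_cancel, hx] at this
      simpa using this.symm
    let E : {x : Site L // chessE L x = b} ≃ {x : Site L // chessE L x = !b} :=
      { toFun := fun x => ⟨x.1 + e, by rw [he, x.2]⟩
        invFun := fun x => ⟨x.1 - e, he' x.1 x.2⟩
        left_inv := fun x => Subtype.ext (add_sub_cancel_right _ _)
        right_inv := fun x => Subtype.ext (sub_add_cancel _ _) }
    refine Fintype.sum_equiv E _ _ fun x => ?_
    simp only [E, Equiv.coe_fn_mk, add_sub_cancel_right]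
    exact mul_comm _ _
  have e1 : isingH h σ = (2 - h) * Fintype.card (Site L) - (∑ x, spin (σ x) * spin (σ (x + east L))
      + ∑ x, spin (σ x) * spin (σ (x + north L))) - h * ∑ x, spin (σ x) := by
    unfold isingH
    simp only [Finset.sum_add_distrib, Finset.sum_sub_distrib, Finset.sum_const, Finset.card_univ,
      nsmul_eq_mul]
    ring
  rw [e1, fib fun x => spin (σ x) * spin (σ (x + east L)),
    fib fun x => spin (σ x) * spin (σ (x + north L)), fib fun x => spin (σ x),
    shift _ (chessE_add_east hL), shift _ (chessE_add_north hL)]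
  simp only [nnS, mul_add, Finset.sum_add_distrib, ← Finset.sum_mul]
  ring

/-- The reversible weight of the kernel `copyP`. -/
noncomputable def weight (β h : ℝ) (v : Half L) : ℝ :=
  Real.exp (-β * ((2 - h) * Fintype.card (Site L)
    - h * ∑ x : {x : Site L // chessE L x = v.1}, spin (ext v x.1))) *
  ∏ x : {x : Site L // chessE L x = !v.1}, (2 * Real.cosh (β * (nnS (ext v) x.1 + h)))

lemma weight_pos (β h : ℝ) (v : Half L) : 0 < weight β h v :=
  mul_pos (Real.exp_pos _) (Finset.prod_pos fun x _ =>
    mul_pos two_pos (Real.cosh_pos (β * (nnS (ext v) x.1 + h))))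

lemma weight_mul_copyP (hL : Even L) (β h : ℝ) (b : Bool) (σ : Config L) :
    weight β h (res b σ) * copyP β h (res b σ) (res (!b) σ) = Real.exp (-β * isingH h σ) := by
  have h1 : weight β h (res b σ) = Real.exp (-β * ((2 - h) * Fintype.card (Site L)
      - h * ∑ x : {x : Site L // chessE L x = b}, spin (σ x.1))) *
      ∏ x : {x : Site L // chessE L x = !b}, (2 * Real.cosh (β * (nnS σ x.1 + h))) := by
    have a1 : ∀ x : {x : Site L // chessE L x = b}, ext (res b σ) x.1 = σ x.1 :=
      fun x => ext_res x.2
    have a2 : ∀ x : {x : Site L // chessE L x = !b}, nnS (ext (res b σ)) x.1 = nnS σ x.1 :=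
      fun x => nnS_ext_res hL σ x.2
    show Real.exp (-β * ((2 - h) * Fintype.card (Site L)
      - h * ∑ x : {x : Site L // chessE L x = b}, spin (ext (res b σ) x.1))) *
      ∏ x : {x : Site L // chessE L x = !b}, (2 * Real.cosh (β * (nnS (ext (res b σ)) x.1 + h))) = _
    simp only [a1, a2]
  rw [h1, copyP_res hL, mul_assoc, ← Finset.prod_mul_distrib]
  have h2 : ∀ x : {x : Site L // chessE L x = !b}, 2 * Real.cosh (β * (nnS σ x.1 + h)) *
      flipP β h σ x.1 (σ x.1) = Real.exp (β * (spin (σ x.1) * (nnS σ x.1 + h))) := by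
    intro x
    rw [flipP_eq]
    have := Real.cosh_pos (β * (nnS σ x.1 + h))
    field_simp
  simp only [h2]
  rw [← Real.exp_sum, ← Real.exp_add, isingH_eq hL h σ b, ← Finset.mul_sum]
  congr 1
  ring

lemma isReversible_copyP (hL : Even L) (β h : ℝ) :
    IsReversible (copyP β h : Half L → Half L → ℝ) (weight β h) where
  toIsStochastic := isStochastic_copyP β h
  pos := weight_pos β h
  balance v w := by
    by_cases hvw : w.1 = !v.1
    · obtain ⟨σ, hv, hw⟩ := exists_res_eq hvw
      rw [hv, hw, weight_mul_copyP hL]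
      have := weight_mul_copyP hL β h (!v.1) σ
      rw [Bool.not_not] at this
      rw [this]
    · have hwv : ¬ v.1 = !w.1 := fun h => hvw (by rw [h, Bool.not_not])
      rw [copyP, copyP, if_neg hvw, if_neg hwv, mul_zero, mul_zero]

end IsingWeight

section Profile

/-- The smallest half-perimeter of a rectangle containing `n` sites. -/
def semiPer (n : ℕ) : ℕ :=
  if n = 0 then 0
  else if Nat.sqrt (n - 1) * Nat.sqrt (n - 1) + Nat.sqrt (n - 1) < n
    then 2 * Nat.sqrt (n - 1) + 2 else 2 * Nat.sqrt (n - 1) + 1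

lemma semiPer_le_add {n a b : ℕ} (hn : n ≤ a * b) : semiPer n ≤ a + b := by
  unfold semiPer
  have h1 := Nat.sqrt_le (n - 1)
  set j := Nat.sqrt (n - 1)
  split_ifs with h0 h2
  · omega
  · by_contra! hc
    have : a + b ≤ 2 * j + 1 := by omega
    zify at *
    nlinarith [sq_nonneg ((a : ℤ) - b), mul_self_le_mul_self (by positivity) this]
  · by_contra! hc
    have h3 : a + b ≤ 2 * j := by omega
    have h4 : j * j + 1 ≤ n := by omega
    clear h1 h2 hc h0
    zify at *
    nlinarith [sq_nonneg ((a : ℤ) - b), mul_self_le_mul_self (by positivity) h3]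

lemma four_mul_le_semiPer_sq (n : ℕ) : 4 * n ≤ semiPer n ^ 2 := by
  unfold semiPer
  have h1 := Nat.lt_succ_sqrt (n - 1)
  set j := Nat.sqrt (n - 1)
  simp only [Nat.succ_eq_add_one] at h1
  split_ifs with h0 h2
  · omega
  · have : n ≤ (j + 1) * (j + 1) := by omega
    nlinarith
  · nlinarith

/-- The energy of the best droplet with `n` plus spins. -/
noncomputable def dropE (h : ℝ) (n : ℕ) : ℝ := 4 * (semiPer n : ℝ) - 2 * h * n

variable {h : ℝ}

lemma dropE_zero : dropE h 0 = 0 := by simp [dropE, semiPer]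

lemma dropE_one : dropE h 1 = 8 - 2 * h := by norm_num [dropE, semiPer]

lemma dropE_two : dropE h 2 = 12 - 4 * h := by
  norm_num [dropE, semiPer]; ring

lemma lam_bounds (h0 : 0 < h) : h * ((lam h : ℝ) - 1) ≤ 2 ∧ 2 < h * lam h := by
  unfold lam
  have h1 := Nat.floor_le (show 0 ≤ 2 / h by positivity)
  have h2 := Nat.lt_floor_add_one (2 / h)
  push_cast
  constructor
  · rw [le_div_iff₀ h0] at h1; linarith
  · rw [div_lt_iff₀ h0] at h2; linarith

lemma three_le_lam (h0 : 0 < h) (h1 : h < 1) : 3 ≤ lam h := by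
  have := (lam_bounds h0).2
  have h2 : (2 : ℝ) < lam h := by nlinarith [(Nat.cast_nonneg (lam h) : (0 : ℝ) ≤ _)]
  exact_mod_cast h2

lemma le_Gam (h0 : 0 < h) (k : ℕ) :
    8 * (k : ℝ) - 2 * h * ((k : ℝ) ^ 2 - k + 1) ≤ Gam h := by
  obtain ⟨b1, b2⟩ := lam_bounds h0
  unfold Gam
  rcases lt_trichotomy k (lam h) with hk | hk | hk
  · have hk' : (k : ℝ) ≤ lam h - 1 := by
      have : k + 1 ≤ lam h := hk
      have : (k : ℝ) + 1 ≤ lam h := by exact_mod_cast this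
      linarith
    nlinarith [mul_nonneg (sub_nonneg.2 hk') h0.le,
      mul_nonneg (show (0 : ℝ) ≤ lam h - k by linarith)
        (show 0 ≤ 8 - 2 * h * (lam h + k - 1) by nlinarith)]
  · rw [hk]; nlinarith
  · have hk' : (lam h : ℝ) + 1 ≤ k := by exact_mod_cast hk
    nlinarith [mul_nonneg (show (0 : ℝ) ≤ k - lam h by linarith)
        (show 0 ≤ 2 * h * (lam h + k - 1) - 8 by nlinarith)]

lemma dropE_le_Gam (h0 : 0 < h) (h1 : h < 1) (n : ℕ) : dropE h n ≤ Gam h := by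
  obtain ⟨b1, b2⟩ := lam_bounds h0
  unfold dropE semiPer
  have hs := Nat.sqrt_le (n - 1)
  set j := Nat.sqrt (n - 1)
  split_ifs with hn h2
  · have := le_Gam h0 1
    subst hn
    norm_num at this ⊢
    linarith
  · have h3 : (j : ℝ) * j + j + 1 ≤ n := by exact_mod_cast h2
    have := le_Gam h0 (j + 1)
    push_cast at this ⊢
    nlinarith
  · have h3 : (j : ℝ) * j + 1 ≤ n := by
      have : j * j + 1 ≤ n := by omega
      exact_mod_cast this
    push_cast
    rcases lt_or_ge j (lam h) with hj | hj
    · have := le_Gam h0 (j + 1)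
      have hj' : (j : ℝ) + 1 ≤ lam h := by exact_mod_cast hj
      push_cast at this
      nlinarith
    · have := le_Gam h0 j
      have hj' : (lam h : ℝ) ≤ j := by exact_mod_cast hj
      nlinarith

/-- The number of plus spins of the critical droplet. -/
noncomputable def critN (h : ℝ) : ℕ := lam h * (lam h - 1) + 1

lemma critN_cast (h : ℝ) : (critN h : ℝ) = (lam h : ℝ) * (lam h - 1) + 1 := by
  have : 1 ≤ lam h := by unfold lam; omega
  unfold critN
  push_cast [this]
  ring

lemma dropE_critN (h0 : 0 < h) (h1 : h < 1) : dropE h (critN h) = Gam h := by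
  have h3 := three_le_lam h0 h1
  have hs : Nat.sqrt (critN h - 1) = lam h - 1 := by
    unfold critN
    obtain ⟨k, hk⟩ : ∃ k, lam h = k + 1 := ⟨lam h - 1, by omega⟩
    rw [hk]
    simp only [Nat.add_sub_cancel]
    have e : (k + 1) * k = k * k + k := by ring
    rw [e]
    exact Nat.sqrt_add_eq k (by omega)
  have he : semiPer (critN h) = 2 * lam h := by
    unfold semiPer
    rw [hs]
    obtain ⟨k, hk⟩ : ∃ k, lam h = k + 1 := ⟨lam h - 1, by omega⟩
    unfold critN
    rw [hk]
    simp only [Nat.add_sub_cancel]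
    rw [if_neg (by omega), if_pos (by nlinarith)]
    ring
  unfold dropE
  rw [he, critN_cast]
  unfold Gam
  push_cast
  ring

lemma dropE_pos (h0 : 0 < h) (h1 : h < 1) {n : ℕ} (hn : 1 ≤ n) (hN : n ≤ critN h) :
    0 < dropE h n := by
  obtain ⟨b1, b2⟩ := lam_bounds h0
  have h4 := four_mul_le_semiPer_sq n
  have h4' : 4 * (n : ℝ) ≤ (semiPer n : ℝ) ^ 2 := by exact_mod_cast h4
  have hN' : (n : ℝ) ≤ (lam h : ℝ) * (lam h - 1) + 1 := by
    rw [← critN_cast]; exact_mod_cast hN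
  have hn' : (1 : ℝ) ≤ n := by exact_mod_cast hn
  have h5 : h ^ 2 * n < 16 := by
    have e1 : h ^ 2 * n ≤ h ^ 2 * ((lam h : ℝ) * (lam h - 1) + 1) := by gcongr
    have e2 : h * (lam h : ℝ) ≤ 3 := by linarith
    have e3 : 0 ≤ h * ((lam h : ℝ) - 1) := by linarith
    nlinarith
  have h6 : (2 * h * n) ^ 2 < (4 * (semiPer n : ℝ)) ^ 2 := by nlinarith
  unfold dropE
  have := abs_lt_of_sq_lt_sq h6 (by positivity)
  linarith [(abs_lt.1 this).2]

lemma exists_dropE_nonpos (h0 : 0 < h) : ∃ n, 1 ≤ n ∧ dropE h n ≤ 0 := by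
  obtain ⟨l, hl⟩ := exists_nat_gt (8 / h)
  rw [div_lt_iff₀ h0] at hl
  have hl0 : 1 ≤ l := by
    by_contra! hc
    have : l = 0 := by omega
    subst this
    norm_num at hl
  refine ⟨l * l, Nat.mul_pos hl0 hl0, ?_⟩
  have := semiPer_le_add (le_refl (l * l))
  have h2 : (semiPer (l * l) : ℝ) ≤ l + l := by exact_mod_cast this
  have hl' : (1 : ℝ) ≤ l := by exact_mod_cast hl0
  unfold dropE
  push_cast
  nlinarith

/-- The droplet size at which the energy of the best droplet becomes nonpositive, and the energy
gaps of smaller droplets. -/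
lemma exists_supercritical (h0 : 0 < h) (h1 : h < 1) :
    ∃ (K : ℕ) (c : ℝ), 0 < c ∧ critN h < K ∧ dropE h K ≤ 0 ∧
      ∀ n, 1 ≤ n → n < K → c ≤ dropE h n := by
  have hex := exists_dropE_nonpos h0
  have hK := Nat.find_spec hex
  set K := Nat.find hex
  have hmin : ∀ n, 1 ≤ n → n < K → 0 < dropE h n := fun n hn hnK => by
    have := Nat.find_min hex hnK
    push Not at this
    exact this hn
  obtain ⟨c, hc, hcE⟩ : ∃ c : ℝ, 0 < c ∧ ∀ n ∈ Finset.Ico 1 K, c ≤ dropE h n := by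
    have : ∀ s : Finset ℕ, (∀ n ∈ s, 0 < dropE h n) → ∃ c : ℝ, 0 < c ∧ ∀ n ∈ s, c ≤ dropE h n := by
      intro s
      induction s using Finset.induction_on with
      | empty => exact fun _ => ⟨1, one_pos, by simp⟩
      | insert a s _ ih =>
        intro hs
        obtain ⟨c, hc, hcs⟩ := ih fun n hn => hs n (Finset.mem_insert_of_mem hn)
        refine ⟨min c (dropE h a), lt_min hc (hs a (Finset.mem_insert_self _ _)), ?_⟩
        intro n hn
        rcases Finset.mem_insert.1 hn with rfl | hn
        · exact min_le_right _ _
        · exact (min_le_left _ _).trans (hcs n hn)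
    exact this _ fun n hn => hmin n (Finset.mem_Ico.1 hn).1 (Finset.mem_Ico.1 hn).2
  refine ⟨K, c, hc, ?_, hK.2, fun n h1 h2 => hcE n (Finset.mem_Ico.2 ⟨h1, h2⟩)⟩
  by_contra! hle
  exact absurd hK.2 (not_le.2 (dropE_pos h0 h1 hK.1 hle))

lemma small_dropE_lt_Gam (h0 : 0 < h) (h1 : h < 1) :
    dropE h 1 < Gam h ∧ dropE h 2 < Gam h := by
  obtain ⟨b1, b2⟩ := lam_bounds h0
  have h3 : (3 : ℝ) ≤ lam h := by exact_mod_cast three_le_lam h0 h1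
  rw [dropE_one, dropE_two]
  unfold Gam
  constructor <;> nlinarith

end Profile

section Geometry

variable {L : ℕ} [NeZero L]

/-- The number of plus spins. -/
noncomputable def cnt (σ : Config L) : ℕ := (Finset.univ.filter fun x => σ x = true).card

/-- The number of plus spins followed by a minus spin in direction `e`. -/
noncomputable def cut (e : Site L) (σ : Config L) : ℕ :=
  (Finset.univ.filter fun x => σ x = true ∧ σ (x + e) = false).card

lemma cnt_eq_sum (σ : Config L) : cnt σ = ∑ x, if σ x = true then 1 else 0 := by
  rw [cnt, Finset.card_filter]

lemma cut_eq_sum (e : Site L) (σ : Config L) :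
    cut e σ = ∑ x, if σ x = true ∧ σ (x + e) = false then 1 else 0 := by
  rw [cut, Finset.card_filter]

lemma cnt_minusC : cnt (minusC L) = 0 := by simp [cnt, minusC]

lemma cnt_plusC : cnt (plusC L) = L * L := by
  simp [cnt, plusC, ZMod.card]

lemma sum_disagreement (e : Site L) (σ : Config L) :
    ∑ x, (1 - spin (σ x) * spin (σ (x + e))) = 4 * (cut e σ : ℝ) := by
  have h1 : ∑ x, (spin (σ (x + e)) - spin (σ x)) = 0 := by
    rw [Finset.sum_sub_distrib, sub_eq_zero]
    exact Equiv.sum_comp (Equiv.addRight e) fun x => spin (σ x)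
  rw [← sub_zero (∑ x, _), ← h1, ← Finset.sum_sub_distrib, cut_eq_sum]
  push_cast
  rw [Finset.mul_sum]
  refine Finset.sum_congr rfl fun x _ => ?_
  cases σ x <;> cases σ (x + e) <;> norm_num [spin]

lemma isingH_eq_cut (h : ℝ) (σ : Config L) :
    isingH h σ = 4 * ((cut (east L) σ : ℝ) + cut (north L) σ) - 2 * h * cnt σ := by
  have h1 : ∑ x, (1 + spin (σ x)) = 2 * (cnt σ : ℝ) := by
    rw [cnt_eq_sum]
    push_cast
    rw [Finset.mul_sum]
    refine Finset.sum_congr rfl fun x _ => ?_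
    cases σ x <;> norm_num [spin]
  unfold isingH
  rw [Finset.sum_add_distrib, sum_disagreement, sum_disagreement, h1]
  ring

lemma isingH_minusC (h : ℝ) : isingH h (minusC L) = 0 := by
  rw [isingH_eq_cut, cnt_minusC]; simp [cut, minusC]

lemma isingH_plusC_add_le {h : ℝ} (h0 : 0 < h) {σ : Config L} (hσ : σ ≠ plusC L) :
    isingH h (plusC L) + 2 * h ≤ isingH h σ := by
  have h1 : cnt σ + 1 ≤ cnt (plusC L) := by
    refine Finset.card_lt_card ?_
    obtain ⟨x, hx⟩ := Function.ne_iff.1 hσ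
    refine Finset.ssubset_iff_of_subset (fun y _ => by simp [plusC]) |>.2 ⟨x, by simp [plusC], ?_⟩
    simpa [plusC] using hx
  have h1' : (cnt σ : ℝ) + 1 ≤ cnt (plusC L) := by exact_mod_cast h1
  have h2 : ∀ e : Site L, cut e (plusC L) = 0 := fun e => by simp [cut, plusC]
  rw [isingH_eq_cut, isingH_eq_cut, h2, h2]
  push_cast
  have : (0 : ℝ) ≤ (cut (east L) σ : ℝ) + cut (north L) σ := by positivity
  nlinarith

lemma cnt_sup_add_cnt_inf (σ τ : Config L) :
    cnt (σ ⊔ τ) + cnt (σ ⊓ τ) = cnt σ + cnt τ := by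
  simp only [cnt_eq_sum, ← Finset.sum_add_distrib]
  refine Finset.sum_congr rfl fun x _ => ?_
  rcases Bool.eq_false_or_eq_true (σ x) with h1 | h1 <;>
    rcases Bool.eq_false_or_eq_true (τ x) with h2 | h2 <;> simp [h1, h2]

lemma cut_sup_add_cut_inf_le (e : Site L) (σ τ : Config L) :
    cut e (σ ⊔ τ) + cut e (σ ⊓ τ) ≤ cut e σ + cut e τ := by
  simp only [cut_eq_sum, ← Finset.sum_add_distrib]
  refine Finset.sum_le_sum fun x _ => ?_
  rcases Bool.eq_false_or_eq_true (σ x) with h1 | h1 <;>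
    rcases Bool.eq_false_or_eq_true (τ x) with h2 | h2 <;>
    rcases Bool.eq_false_or_eq_true (σ (x + e)) with h3 | h3 <;>
    rcases Bool.eq_false_or_eq_true (τ (x + e)) with h4 | h4 <;> simp [h1, h2, h3, h4]

lemma isingH_sup_add_inf_le (h : ℝ) (σ τ : Config L) :
    isingH h (σ ⊔ τ) + isingH h (σ ⊓ τ) ≤ isingH h σ + isingH h τ := by
  have h1 : (cut (east L) (σ ⊔ τ) : ℝ) + cut (east L) (σ ⊓ τ) ≤
      cut (east L) σ + cut (east L) τ := by
    exact_mod_cast cut_sup_add_cut_inf_le (east L) σ τ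
  have h2 : (cut (north L) (σ ⊔ τ) : ℝ) + cut (north L) (σ ⊓ τ) ≤
      cut (north L) σ + cut (north L) τ := by
    exact_mod_cast cut_sup_add_cut_inf_le (north L) σ τ
  have h3 : (cnt (σ ⊔ τ) : ℝ) + cnt (σ ⊓ τ) = cnt σ + cnt τ := by
    exact_mod_cast cnt_sup_add_cnt_inf σ τ
  simp only [isingH_eq_cut]
  have : h * ((cnt (σ ⊔ τ) : ℝ) + cnt (σ ⊓ τ)) = h * (cnt σ + cnt τ) := by rw [h3]
  linarith

lemma forall_add_east {p : Site L → Prop} (hp : ∀ x, p x → p (x + east L)) {x : Site L} (hx : p x)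
    (t : ZMod L) : p (x.1 + t, x.2) := by
  have : ∀ n : ℕ, p (x.1 + n, x.2) := by
    intro n
    induction n with
    | zero => simpa using hx
    | succ n ih =>
      have := hp _ ih
      simpa [east, add_assoc] using this
  simpa using this t.val

lemma forall_add_north {p : Site L → Prop} (hp : ∀ x, p x → p (x + north L)) {x : Site L}
    (hx : p x) (t : ZMod L) : p (x.1, x.2 + t) := by
  have : ∀ n : ℕ, p (x.1, x.2 + n) := by
    intro n
    induction n with
    | zero => simpa using hx
    | succ n ih =>
      have := hp _ ih
      simpa [north, add_assoc] using this
  simpa using this t.val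

/-- A nonempty droplet with fewer than `L` plus spins is cut in each of the rows it meets. -/
lemma rows_le_cut_east {σ : Config L} (hσ : cnt σ < L) :
    ((Finset.univ.filter fun x => σ x = true).image Prod.snd).card ≤ cut (east L) σ := by
  refine (Finset.card_le_card ?_).trans
    (Finset.card_image_le (s := Finset.univ.filter fun x => σ x = true ∧ σ (x + east L) = false)
      (f := Prod.snd))
  intro j hj
  obtain ⟨x, hx, rfl⟩ := Finset.mem_image.1 hj
  rw [Finset.mem_filter] at hx
  by_contra hc
  have hp : ∀ y : Site L, σ y = true ∧ y.2 = x.2 →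
      σ (y + east L) = true ∧ (y + east L).2 = x.2 := by
    rintro y ⟨hy, hyx⟩
    refine ⟨?_, by simp [east, hyx]⟩
    by_contra hf
    exact hc (Finset.mem_image.2 ⟨y, by simp [hy, Bool.eq_false_of_not_eq_true hf], hyx⟩)
  have hrow := forall_add_east (p := fun y => σ y = true ∧ y.2 = x.2) hp ⟨hx.2, rfl⟩
  refine absurd hσ (not_lt.2 ?_)
  calc L = (Finset.univ : Finset (ZMod L)).card := by rw [Finset.card_univ, ZMod.card]
    _ = (Finset.univ.image fun t : ZMod L => (x.1 + t, x.2)).card :=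
        (Finset.card_image_of_injective _ fun a b hab => by simpa using hab).symm
    _ ≤ cnt σ := Finset.card_le_card fun y hy => by
        obtain ⟨t, -, rfl⟩ := Finset.mem_image.1 hy
        simpa using (hrow t).1

lemma cols_le_cut_north {σ : Config L} (hσ : cnt σ < L) :
    ((Finset.univ.filter fun x => σ x = true).image Prod.fst).card ≤ cut (north L) σ := by
  refine (Finset.card_le_card ?_).trans
    (Finset.card_image_le (s := Finset.univ.filter fun x => σ x = true ∧ σ (x + north L) = false)
      (f := Prod.fst))
  intro j hj
  obtain ⟨x, hx, rfl⟩ := Finset.mem_image.1 hj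
  rw [Finset.mem_filter] at hx
  by_contra hc
  have hp : ∀ y : Site L, σ y = true ∧ y.1 = x.1 →
      σ (y + north L) = true ∧ (y + north L).1 = x.1 := by
    rintro y ⟨hy, hyx⟩
    refine ⟨?_, by simp [north, hyx]⟩
    by_contra hf
    exact hc (Finset.mem_image.2 ⟨y, by simp [hy, Bool.eq_false_of_not_eq_true hf], hyx⟩)
  have hrow := forall_add_north (p := fun y => σ y = true ∧ y.1 = x.1) hp ⟨hx.2, rfl⟩
  refine absurd hσ (not_lt.2 ?_)
  calc L = (Finset.univ : Finset (ZMod L)).card := by rw [Finset.card_univ, ZMod.card]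
    _ = (Finset.univ.image fun t : ZMod L => (x.1, x.2 + t)).card :=
        (Finset.card_image_of_injective _ fun a b hab => by simpa using hab).symm
    _ ≤ cnt σ := Finset.card_le_card fun y hy => by
        obtain ⟨t, -, rfl⟩ := Finset.mem_image.1 hy
        simpa using (hrow t).1

/-- The isoperimetric inequality on the torus for fewer than `L` plus spins. -/
lemma dropE_le_isingH (h : ℝ) {σ : Config L} (hσ : cnt σ < L) : dropE h (cnt σ) ≤ isingH h σ := by
  have h1 : cnt σ ≤ ((Finset.univ.filter fun x => σ x = true).image Prod.fst).card *
      ((Finset.univ.filter fun x => σ x = true).image Prod.snd).card := by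
    rw [← Finset.card_product]
    refine Finset.card_le_card fun x hx => ?_
    exact Finset.mem_product.2 ⟨Finset.mem_image_of_mem _ hx, Finset.mem_image_of_mem _ hx⟩
  have h2 := semiPer_le_add h1
  have h3 : semiPer (cnt σ) ≤ cut (east L) σ + cut (north L) σ := by
    have := rows_le_cut_east hσ
    have := cols_le_cut_north hσ
    omega
  have h3' : (semiPer (cnt σ) : ℝ) ≤ cut (east L) σ + cut (north L) σ := by exact_mod_cast h3
  rw [isingH_eq_cut]
  unfold dropE
  linarith

/-- The growing quasi-square droplets with corner `c`. -/
def drop (c : Site L) (n : ℕ) : Config L :=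
  fun x => decide (Nat.pair (x - c).1.val (x - c).2.val < n)

omit [NeZero L] in
lemma drop_zero (c : Site L) : drop c 0 = minusC L := by
  funext x; simp [drop, minusC]

omit [NeZero L] in
lemma drop_apply_iff {c x : Site L} {n : ℕ} :
    drop c n x = true ↔ Nat.pair (x - c).1.val (x - c).2.val < n := by simp [drop]

lemma cnt_drop (c : Site L) {n : ℕ} (hn : n ≤ L) : cnt (drop c n) = n := by
  conv_rhs => rw [← Finset.card_range n]
  refine Finset.card_bij (fun x _ => Nat.pair (x - c).1.val (x - c).2.val) ?_ ?_ ?_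
  · intro x hx
    rw [Finset.mem_filter, drop_apply_iff] at hx
    exact Finset.mem_range.2 hx.2
  · intro x _ y _ hxy
    obtain ⟨h1, h2⟩ := Nat.pair_eq_pair.1 hxy
    have h1 := ZMod.val_injective _ h1
    have h2 := ZMod.val_injective _ h2
    exact sub_left_injective (Prod.ext h1 h2)
  · intro k hk
    rw [Finset.mem_range] at hk
    refine ⟨c + (((Nat.unpair k).1 : ZMod L), ((Nat.unpair k).2 : ZMod L)), ?_, ?_⟩
    all_goals
      have h1 : (((Nat.unpair k).1 : ℕ) : ZMod L).val = (Nat.unpair k).1 :=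
        ZMod.val_cast_of_lt (lt_of_le_of_lt (Nat.unpair_left_le k) (hk.trans_le hn))
      have h2 : (((Nat.unpair k).2 : ℕ) : ZMod L).val = (Nat.unpair k).2 :=
        ZMod.val_cast_of_lt (lt_of_le_of_lt (Nat.unpair_right_le k) (hk.trans_le hn))
    · rw [Finset.mem_filter, drop_apply_iff, add_sub_cancel_left, h1, h2, Nat.pair_unpair]
      exact ⟨Finset.mem_univ _, hk⟩
    · simp only [add_sub_cancel_left, h1, h2, Nat.pair_unpair]

omit [NeZero L] in
lemma val_add_one_of_lt_pair (hL : 2 ≤ L) {a : ZMod L} {m : ℕ} (ha : a.val < m) (hm : m < L) :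
    (a + 1).val = a.val + 1 := by
  have : Fact (1 < L) := ⟨hL⟩
  have h1 : (1 : ZMod L).val = 1 := ZMod.val_one L
  rw [ZMod.val_add_of_lt, h1]
  rw [h1]; omega

lemma cut_east_drop_le (c : Site L) (n : ℕ) (hL : 2 ≤ L) :
    cut (east L) (drop c n) ≤ Nat.sqrt (n - 1) + 1 := by
  rw [← Finset.card_range (Nat.sqrt (n - 1) + 1)]
  refine Finset.card_le_card_of_injOn (fun x => (x - c).2.val) ?_ ?_
  · intro x hx
    have hx := (Finset.mem_filter.1 (Finset.mem_coe.1 hx)).2.1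
    rw [drop_apply_iff] at hx
    refine Finset.mem_coe.2 (Finset.mem_range.2 (Nat.lt_succ_of_le (Nat.le_sqrt.2 ?_)))
    have h1 : Nat.pair 0 (x - c).2.val ≤ Nat.pair (x - c).1.val (x - c).2.val := by
      rcases Nat.eq_zero_or_pos (x - c).1.val with h | h
      · rw [h]
      · exact (Nat.pair_lt_pair_left _ h).le
    have h2 : Nat.pair 0 (x - c).2.val = (x - c).2.val * (x - c).2.val := by
      unfold Nat.pair
      split_ifs with h
      · simp
      · have : (x - c).2.val = 0 := by omega
        rw [this]
    show (x - c).2.val * (x - c).2.val ≤ n - 1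
    omega
  · intro x hx y hy hxy
    have key : ∀ x y : Site L, drop c n x = true → drop c n (x + east L) = false →
        drop c n y = true → (x - c).2.val = (y - c).2.val → (y - c).1.val ≤ (x - c).1.val := by
      intro x y hx hx' hy hxy
      by_contra! hlt
      have e1 : (x + east L - c) = ((x - c).1 + 1, (x - c).2) := by
        ext <;> simp [east]; ring
      have hv := val_add_one_of_lt_pair hL hlt (ZMod.val_lt _)
      have : drop c n (x + east L) = true := by
        rw [drop_apply_iff] at hy ⊢
        rw [e1]
        simp only [hv, hxy]
        refine lt_of_le_of_lt ?_ hy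
        rcases Nat.lt_or_eq_of_le (Nat.succ_le_of_lt hlt) with h | h
        · exact (Nat.pair_lt_pair_left _ h).le
        · rw [← h]
      rw [this] at hx'
      exact absurd hx' (by simp)
    have hx := (Finset.mem_filter.1 (Finset.mem_coe.1 hx)).2
    have hy := (Finset.mem_filter.1 (Finset.mem_coe.1 hy)).2
    have h1 := le_antisymm (key y x hy.1 hy.2 hx.1 hxy.symm) (key x y hx.1 hx.2 hy.1 hxy)
    exact sub_left_injective (Prod.ext (ZMod.val_injective _ h1) (ZMod.val_injective _ hxy))

lemma cut_north_drop_le (c : Site L) (n : ℕ) (hL : 2 ≤ L) :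
    cut (north L) (drop c n) ≤
      if Nat.sqrt (n - 1) * Nat.sqrt (n - 1) + Nat.sqrt (n - 1) < n
        then Nat.sqrt (n - 1) + 1 else Nat.sqrt (n - 1) := by
  rw [← Finset.card_range (ite (Nat.sqrt (n - 1) * Nat.sqrt (n - 1) + Nat.sqrt (n - 1) < n)
    (Nat.sqrt (n - 1) + 1) (Nat.sqrt (n - 1)))]
  refine Finset.card_le_card_of_injOn (fun x => (x - c).1.val) ?_ ?_
  · intro x hx
    have hx := (Finset.mem_filter.1 (Finset.mem_coe.1 hx)).2.1
    rw [drop_apply_iff] at hx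
    have h1 : Nat.pair (x - c).1.val 0 ≤ Nat.pair (x - c).1.val (x - c).2.val := by
      rcases Nat.eq_zero_or_pos (x - c).2.val with h | h
      · rw [h]
      · exact (Nat.pair_lt_pair_right _ h).le
    have h2 : Nat.pair (x - c).1.val 0 = (x - c).1.val * (x - c).1.val + (x - c).1.val := by
      simp [Nat.pair]
    have h3 : (x - c).1.val ≤ Nat.sqrt (n - 1) := Nat.le_sqrt.2 (by omega)
    refine Finset.mem_coe.2 (Finset.mem_range.2 ?_)
    show (x - c).1.val < _
    split_ifs with hs
    · omega
    · refine lt_of_le_of_ne h3 fun he => hs ?_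
      rw [← he]; omega
  · intro x hx y hy hxy
    have key : ∀ x y : Site L, drop c n x = true → drop c n (x + north L) = false →
        drop c n y = true → (x - c).1.val = (y - c).1.val → (y - c).2.val ≤ (x - c).2.val := by
      intro x y hx hx' hy hxy
      by_contra! hlt
      have e1 : (x + north L - c) = ((x - c).1, (x - c).2 + 1) := by
        ext <;> simp [north]; ring
      have hv := val_add_one_of_lt_pair hL hlt (ZMod.val_lt _)
      have : drop c n (x + north L) = true := by
        rw [drop_apply_iff] at hy ⊢
        rw [e1]
        simp only [hv, hxy]
        refine lt_of_le_of_lt ?_ hy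
        rcases Nat.lt_or_eq_of_le (Nat.succ_le_of_lt hlt) with h | h
        · exact (Nat.pair_lt_pair_right _ h).le
        · rw [← h]
      rw [this] at hx'
      exact absurd hx' (by simp)
    have hx := (Finset.mem_filter.1 (Finset.mem_coe.1 hx)).2
    have hy := (Finset.mem_filter.1 (Finset.mem_coe.1 hy)).2
    have h1 := le_antisymm (key y x hy.1 hy.2 hx.1 hxy.symm) (key x y hx.1 hx.2 hy.1 hxy)
    exact sub_left_injective (Prod.ext (ZMod.val_injective _ hxy) (ZMod.val_injective _ h1))

lemma isingH_drop_le (h : ℝ) (c : Site L) {n : ℕ} (hn : n ≤ L) (hL : 2 ≤ L) :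
    isingH h (drop c n) ≤ dropE h n := by
  rcases Nat.eq_zero_or_pos n with rfl | hn0
  · rw [drop_zero, isingH_minusC, dropE_zero]
  have h1 := cut_east_drop_le c n hL
  have h2 := cut_north_drop_le c n hL
  have h3 : cut (east L) (drop c n) + cut (north L) (drop c n) ≤ semiPer n := by
    unfold semiPer
    rw [if_neg (by omega)]
    split_ifs at h2 ⊢ <;> omega
  have h3' : (cut (east L) (drop c n) : ℝ) + cut (north L) (drop c n) ≤ semiPer n := by
    exact_mod_cast h3
  rw [isingH_eq_cut, cnt_drop c hn]
  unfold dropE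
  linarith

end Geometry

section Landscape

variable {L : ℕ} [NeZero L] {h : ℝ}

/-- `σ` and `η` are linked by a chain of sublattice updates of energy at most `θ`: a function on
the sublattice configurations varies little between them if it varies little along all the
updates of energy at most `θ`. -/
def Joined (h θ : ℝ) (σ η : Config L) : Prop :=
  ∃ n : ℕ, ∀ (f : Half L → ℝ) (d : ℝ), 0 ≤ d →
    (∀ ξ : Config L, isingH h ξ ≤ θ → |f (res true ξ) - f (res false ξ)| ≤ d) →
    |f (res true σ) - f (res true η)| ≤ n * d

lemma Joined.refl (θ : ℝ) (σ : Config L) : Joined h θ σ σ := ⟨0, by simp⟩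

lemma Joined.symm {θ : ℝ} {σ η : Config L} (hj : Joined h θ σ η) : Joined h θ η σ := by
  obtain ⟨n, hn⟩ := hj
  exact ⟨n, fun f d hd hf => by rw [abs_sub_comm]; exact hn f d hd hf⟩

lemma Joined.trans {θ : ℝ} {σ η ζ : Config L} (h1 : Joined h θ σ η) (h2 : Joined h θ η ζ) :
    Joined h θ σ ζ := by
  obtain ⟨n, hn⟩ := h1
  obtain ⟨m, hm⟩ := h2
  refine ⟨n + m, fun f d hd hf => ?_⟩
  have := abs_sub_le (f (res true σ)) (f (res true η)) (f (res true ζ))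
  have a1 := hn f d hd hf
  have a2 := hm f d hd hf
  push_cast
  linarith

lemma Joined.mono {θ θ' : ℝ} (hθ : θ ≤ θ') {σ η : Config L} (hj : Joined h θ σ η) :
    Joined h θ' σ η := by
  obtain ⟨n, hn⟩ := hj
  exact ⟨n, fun f d hd hf => hn f d hd fun ξ hξ => hf ξ (hξ.trans hθ)⟩

lemma Joined.of_res_eq {θ : ℝ} {σ η : Config L} {b : Bool} (hb : res b σ = res b η)
    (hσ : isingH h σ ≤ θ) (hη : isingH h η ≤ θ) : Joined h θ σ η := by
  refine ⟨2, fun f d hd hf => ?_⟩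
  have a1 := hf σ hσ
  have a2 := hf η hη
  push_cast
  cases b
  · have := abs_sub_le (f (res true σ)) (f (res false σ)) (f (res true η))
    rw [hb] at this a1
    rw [abs_sub_comm (f (res true η))] at a2
    linarith
  · rw [hb]; simp; linarith

lemma Joined.of_path {θ : ℝ} (z : ℕ → Config L) (n : ℕ)
    (hz : ∀ k ≤ n, isingH h (z k) ≤ θ) (hstep : ∀ k < n, ∃ b, res b (z k) = res b (z (k + 1))) :
    Joined h θ (z 0) (z n) := by
  induction n with
  | zero => exact Joined.refl _ _
  | succ n ih =>
    obtain ⟨b, hb⟩ := hstep n (Nat.lt_succ_self n)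
    exact (ih (fun k hk => hz k (by omega)) fun k hk => hstep k (by omega)).trans
      (Joined.of_res_eq hb (hz n (by omega)) (hz (n + 1) le_rfl))

/-- Consecutive droplets differ at one site at most, also after adding a background. -/
lemma exists_res_sup_drop_eq (c : Site L) (y : Config L) (k : ℕ) :
    ∃ b, res b (y ⊔ drop c k) = res b (y ⊔ drop c (k + 1)) := by
  by_cases hx : ∃ x : Site L, Nat.pair (x - c).1.val (x - c).2.val = k
  · obtain ⟨x, hx⟩ := hx
    refine ⟨!chessE L x, res_eq_res_iff.2 fun y' hy' => ?_⟩
    have hne : Nat.pair (y' - c).1.val (y' - c).2.val ≠ k := by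
      intro he
      rw [← hx] at he
      obtain ⟨h1, h2⟩ := Nat.pair_eq_pair.1 he
      have : y' = x := sub_left_injective
        (Prod.ext (ZMod.val_injective _ h1) (ZMod.val_injective _ h2))
      rw [this] at hy'
      simp at hy'
    have : drop c k y' = drop c (k + 1) y' := by
      unfold drop
      congr 1
      exact propext ⟨fun h => by omega, fun h => by omega⟩
    simp [Pi.sup_apply, this]
  · refine ⟨true, res_eq_res_iff.2 fun y' _ => ?_⟩
    have hne : Nat.pair (y' - c).1.val (y' - c).2.val ≠ k := fun he => hx ⟨y', he⟩
    have : drop c k y' = drop c (k + 1) y' := by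
      unfold drop
      congr 1
      exact propext ⟨fun h => by omega, fun h => by omega⟩
    simp [Pi.sup_apply, this]

lemma one_le_cnt {σ : Config L} {x : Site L} (hx : σ x = true) : 1 ≤ cnt σ :=
  Finset.card_pos.2 ⟨x, by simpa using hx⟩

/-- A configuration other than the two homogeneous ones has a minus spin with a plus spin to its
east or to its north. -/
lemma exists_boundary {y : Config L} (hm : y ≠ minusC L) (hp : y ≠ plusC L) :
    ∃ x, y x = false ∧ (y (x + east L) = true ∨ y (x + north L) = true) := by
  by_contra! hc
  obtain ⟨x, hx⟩ := Function.ne_iff.1 hp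
  have hx : y x = false := by simpa [plusC] using hx
  refine hm (funext fun z => ?_)
  have h1 := forall_add_east (p := fun x => y x = false)
    (fun x hx => by simpa using (hc x hx).1) hx (z.1 - x.1)
  have h2 := forall_add_north (p := fun x => y x = false)
    (fun x hx => by simpa using (hc x hx).2) h1 (z.2 - x.2)
  simpa [minusC] using h2

/-- Every configuration other than the homogeneous ones can be lowered in energy by growing a
droplet next to one of its plus spins, at a cost less than the nucleation barrier. -/
lemma exists_lower (h0 : 0 < h) (h1 : h < 1) {K : ℕ} {c Γ' : ℝ} (hc : 0 < c) (hK3 : 3 ≤ K)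
    (hKE : dropE h K ≤ 0) (hKc : ∀ n, 1 ≤ n → n < K → c ≤ dropE h n)
    (hΓ0 : 0 ≤ Γ') (hΓ1 : dropE h 1 ≤ Γ') (hΓ2 : dropE h 2 ≤ Γ') (hΓ3 : Gam h - c ≤ Γ')
    (hKL : K < L) {y : Config L} (hm : y ≠ minusC L) (hp : y ≠ plusC L) :
    ∃ y', isingH h y' < isingH h y ∧ Joined h (isingH h y + Γ') y y' := by
  obtain ⟨x, hx, hxn⟩ := exists_boundary hm hp
  have hlt : ∀ k, 1 ≤ k → k ≤ K → cnt (y ⊓ drop x k) < k := by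
    intro k hk1 hkK
    conv_rhs => rw [← cnt_drop x (show k ≤ L by omega)]
    refine Finset.card_lt_card ?_
    refine Finset.ssubset_iff_of_subset (fun z hz => ?_) |>.2 ⟨x, ?_, ?_⟩
    · simp only [Finset.mem_filter, Finset.mem_univ, true_and, Pi.inf_apply] at hz ⊢
      revert hz
      cases drop x k z <;> simp
    · simp [drop_apply_iff, Nat.pair]
      omega
    · simp [hx]
  have hge : ∀ k, 3 ≤ k → 1 ≤ cnt (y ⊓ drop x k) := by
    intro k hk
    have hL1 : (1 : ZMod L).val = 1 := by
      have : Fact (1 < L) := ⟨by omega⟩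
      exact ZMod.val_one L
    rcases hxn with hxn | hxn
    · refine one_le_cnt (x := x + east L) ?_
      have : drop x k (x + east L) = true := by
        rw [drop_apply_iff]; simp [east, hL1, Nat.pair]; omega
      simp [this, hxn]
    · refine one_le_cnt (x := x + north L) ?_
      have : drop x k (x + north L) = true := by
        rw [drop_apply_iff]; simp [north, hL1, Nat.pair]; omega
      simp [this, hxn]
  have hsub : ∀ k, k ≤ K → isingH h (y ⊔ drop x k) ≤
      isingH h y + dropE h k - isingH h (y ⊓ drop x k) := by
    intro k hk
    have := isingH_sup_add_inf_le h y (drop x k)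
    have := isingH_drop_le h x (show k ≤ L by omega) (by omega)
    linarith
  have hinf : ∀ k, 1 ≤ k → k ≤ K → 0 ≤ isingH h (y ⊓ drop x k) ∧
      (3 ≤ k → c ≤ isingH h (y ⊓ drop x k)) := by
    intro k hk1 hkK
    have h1 := hlt k hk1 hkK
    have h2 := dropE_le_isingH h (σ := y ⊓ drop x k) (by omega)
    constructor
    · rcases Nat.eq_zero_or_pos (cnt (y ⊓ drop x k)) with h3 | h3
      · rw [h3, dropE_zero] at h2; exact h2
      · exact hc.le.trans ((hKc _ h3 (by omega)).trans h2)
    · intro hk3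
      exact (hKc _ (hge k hk3) (by omega)).trans h2
  refine ⟨y ⊔ drop x K, ?_, ?_⟩
  · have := hsub K le_rfl
    have := (hinf K (by omega) le_rfl).2 hK3
    linarith
  · have hz0 : y ⊔ drop x 0 = y := by
      rw [drop_zero]; funext z; simp [minusC]
    have := Joined.of_path (h := h) (θ := isingH h y + Γ') (fun k => y ⊔ drop x k) K ?_ ?_
    · simpa only [hz0] using this
    · intro k hk
      rcases Nat.lt_or_ge k 3 with hk3 | hk3
      · interval_cases k
        · simp only [hz0]; linarith
        · have := hsub 1 hk
          have := (hinf 1 le_rfl hk).1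
          linarith
        · have := hsub 2 hk
          have := (hinf 2 (by norm_num) hk).1
          linarith
      · have := hsub k hk
        have := (hinf k (by omega) hk).2 hk3
        have := dropE_le_Gam h0 h1 k
        linarith
    · exact fun k _ => exists_res_sup_drop_eq x y k

/-- The energy landscape: every configuration is linked to one of the homogeneous ones within a
height `Γ'` smaller than the barrier `Γ`, and to the all-plus one within the height `Γ`. -/
lemma exists_landscape (h0 : 0 < h) (h1 : h < 1) :
    ∃ (K : ℕ) (Γ' : ℝ), 3 ≤ K ∧ critN h < K ∧ 0 ≤ Γ' ∧ Γ' < Gam h ∧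
      ∀ (L : ℕ) [NeZero L], K < L → ∀ y : Config L,
        (Joined h (isingH h y + Γ') y (minusC L) ∨ Joined h (isingH h y + Γ') y (plusC L)) ∧
        Joined h (isingH h y + Gam h) y (plusC L) := by
  obtain ⟨K, c, hc, hNK, hKE, hKc⟩ := exists_supercritical h0 h1
  obtain ⟨hs1, hs2⟩ := small_dropE_lt_Gam h0 h1
  have hp1 : 0 < dropE h 1 := by rw [dropE_one]; linarith
  have h3 := three_le_lam h0 h1
  have hK3 : 3 ≤ K := by
    unfold critN at hNK
    have : 2 ≤ lam h - 1 := by omega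
    nlinarith
  set Γ' := max (max (dropE h 1) (dropE h 2)) (Gam h - c) with hΓ'
  have e1 : dropE h 1 ≤ Γ' := (le_max_left _ _).trans (le_max_left _ _)
  have e2 : dropE h 2 ≤ Γ' := (le_max_right _ _).trans (le_max_left _ _)
  have e3 : Gam h - c ≤ Γ' := le_max_right _ _
  have hΓlt : Γ' < Gam h := max_lt (max_lt hs1 hs2) (by linarith)
  refine ⟨K, Γ', hK3, hNK, by linarith, hΓlt, fun L _ hKL => ?_⟩
  have hlow := fun (y : Config L) hm hp => exists_lower h0 h1 hc hK3 hKE hKc (by linarith) e1 e2 e3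
    hKL (y := y) hm hp
  have wf : WellFounded fun a b : Config L => isingH h a < isingH h b :=
    @Finite.wellFounded_of_trans_of_irrefl _ _ _ ⟨fun a b c => lt_trans⟩ ⟨fun a => lt_irrefl _⟩
  have hA : ∀ y : Config L,
      Joined h (isingH h y + Γ') y (minusC L) ∨ Joined h (isingH h y + Γ') y (plusC L) := by
    intro y
    induction y using wf.induction with
    | _ y ih =>
      by_cases hm : y = minusC L
      · exact Or.inl (hm ▸ Joined.refl _ _)
      by_cases hp : y = plusC L
      · exact Or.inr (hp ▸ Joined.refl _ _)
      obtain ⟨y', hy', hj⟩ := hlow y hm hp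
      exact (ih y' hy').imp (fun hz => hj.trans (hz.mono (by linarith)))
        fun hz => hj.trans (hz.mono (by linarith))
  have hB : ∀ y : Config L, y ≠ minusC L → isingH h y ≤ 0 →
      Joined h (isingH h y + Γ') y (plusC L) := by
    intro y
    induction y using wf.induction with
    | _ y ih =>
      intro hm hy
      by_cases hp : y = plusC L
      · exact hp ▸ Joined.refl _ _
      obtain ⟨y', hy', hj⟩ := hlow y hm hp
      refine hj.trans ((ih y' hy' ?_ (by linarith)).mono (by linarith))
      rintro rfl
      rw [isingH_minusC] at hy'
      linarith
  have hM : Joined h (Gam h) (minusC L) (plusC L) := by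
    have hz0 : minusC L ⊔ drop 0 0 = minusC L := by
      rw [drop_zero]; funext z; simp [minusC]
    have hd : ∀ k, minusC L ⊔ drop 0 k = drop 0 k := fun k => by funext z; simp [minusC]
    have hpath := Joined.of_path (h := h) (θ := Gam h) (fun k => minusC L ⊔ drop 0 k) K
      (fun k hk => by
        simp only [hd]
        exact (isingH_drop_le h 0 (by omega) (by omega)).trans (dropE_le_Gam h0 h1 k))
      (fun k _ => exists_res_sup_drop_eq 0 _ k)
    simp only [hz0, hd] at hpath
    have hHK : isingH h (drop (0 : Site L) K) ≤ 0 :=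
      (isingH_drop_le h 0 (by omega) (by omega)).trans hKE
    refine hpath.trans ((hB _ ?_ hHK).mono (by linarith))
    intro he
    have := cnt_drop (0 : Site L) hKL.le
    rw [he, cnt_minusC] at this
    omega
  refine fun y => ⟨hA y, ?_⟩
  by_cases hy : isingH h y ≤ 0
  · by_cases hm : y = minusC L
    · rw [hm, isingH_minusC, zero_add]; exact hM
    · exact (hB y hm hy).mono (by linarith)
  · rcases hA y with hj | hj
    · exact (hj.mono (by linarith)).trans (hM.mono (by linarith))
    · exact hj.mono (by linarith)

/-- The most likely image of a sublattice configuration, joined to this configuration. -/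
noncomputable def comp (h : ℝ) (v : Half L) : Config L :=
  fun x => if chessE L x = v.1 then ext v x else decide (0 < nnS (ext v) x + h)

lemma isingH_le_of_comp (hL : Even L) {σ ξ : Config L} {b : Bool}
    (hξ : ∀ x, ξ x = σ x ∨ ξ x = comp h (res b σ) x) : isingH h ξ ≤ isingH h σ := by
  have hb : ∀ x, chessE L x = b → ξ x = σ x := by
    intro x hx
    rcases hξ x with h | h
    · exact h
    · rw [h, comp, if_pos (show chessE L x = (res b σ).1 from hx), ext_res hx]
  have hres : res b ξ = res b σ := res_eq_res_iff.2 hb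
  have hn : ∀ x, chessE L x = (!b) → nnS ξ x = nnS σ x := by
    intro x hx
    rw [← nnS_ext_res hL ξ hx, hres, nnS_ext_res hL σ hx]
  rw [isingH_eq hL h ξ b, isingH_eq hL h σ b]
  have e1 : ∑ x : {x : Site L // chessE L x = b}, spin (ξ x.1) =
      ∑ x : {x : Site L // chessE L x = b}, spin (σ x.1) :=
    Finset.sum_congr rfl fun x _ => by rw [hb x.1 x.2]
  have e2 : ∑ x : {x : Site L // chessE L x = !b}, spin (σ x.1) * (nnS σ x.1 + h) ≤
      ∑ x : {x : Site L // chessE L x = !b}, spin (ξ x.1) * (nnS ξ x.1 + h) := by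
    refine Finset.sum_le_sum fun x _ => ?_
    rw [hn x.1 x.2]
    rcases hξ x.1 with h1 | h1
    · rw [h1]
    · have hne : ¬ chessE L x.1 = (res b σ).1 := by
        have : chessE L x.1 = !b := x.2
        rw [this]; cases b <;> simp [res]
      rw [h1, comp, if_neg hne, nnS_ext_res hL σ x.2]
      by_cases hpos : 0 < nnS σ x.1 + h
      · simp only [hpos, decide_true]
        cases σ x.1 <;> simp [spin]
        linarith
      · simp only [hpos, decide_false]
        cases σ x.1 <;> simp [spin]
        linarith
  rw [e1]
  linarith

omit [NeZero L] in
lemma exists_between_cnt [NeZero L] {σ τ : Config L} {N : ℕ} (hσ : cnt σ < N) (hτ : N ≤ cnt τ) :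
    ∃ ξ : Config L, cnt ξ = N ∧ ∀ x, ξ x = σ x ∨ ξ x = τ x := by
  obtain ⟨u, hu1, hu2, hu⟩ := Finset.exists_subsuperset_card_eq
    (s := Finset.univ.filter fun x => σ x = true ∧ τ x = true)
    (t := Finset.univ.filter fun x => τ x = true) (n := N)
    (fun x hx => by simp only [Finset.mem_filter, Finset.mem_univ, true_and] at hx ⊢; exact hx.2)
    ((Finset.card_le_card fun x hx => by
      simp only [Finset.mem_filter, Finset.mem_univ, true_and] at hx ⊢; exact hx.1).trans hσ.le) hτ
  refine ⟨fun x => decide (x ∈ u), ?_, fun x => ?_⟩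
  · rw [← hu, cnt]
    congr 1
    ext x
    simp
  · have a1 : σ x = true ∧ τ x = true → x ∈ u := fun hx => hu1 (by simpa using hx)
    have a2 : x ∈ u → τ x = true := fun hx => by simpa using hu2 hx
    by_cases hx : x ∈ u
    · exact Or.inr (by simp [hx, a2 hx])
    · simp only [hx, decide_false]
      cases hs : σ x
      · exact Or.inl rfl
      · right
        by_contra hc
        exact hx (a1 ⟨hs, by simpa using Ne.symm hc⟩)

/-- The sublattice configurations which have passed the saddle. -/
def Super (h : ℝ) (L : ℕ) [NeZero L] : Set (Half L) := {v | critN h ≤ cnt (comp h v)}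

lemma Gam_le_isingH_of_cross (h0 : 0 < h) (h1 : h < 1) (hL : Even L) (hNL : critN h < L)
    {σ : Config L} {b b' : Bool} (hb : res b σ ∉ Super h L) (hb' : res b' σ ∈ Super h L) :
    Gam h ≤ isingH h σ := by
  have key : ∀ ξ : Config L, cnt ξ = critN h → isingH h ξ ≤ isingH h σ → Gam h ≤ isingH h σ := by
    intro ξ hξ hle
    have := dropE_le_isingH h (σ := ξ) (by omega)
    rw [hξ, dropE_critN h0 h1] at this
    linarith
  simp only [Super, Set.mem_ofPred_eq, not_le] at hb hb'
  rcases lt_or_ge (cnt σ) (critN h) with hc | hc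
  · obtain ⟨ξ, hξ, hx⟩ := exists_between_cnt hc hb'
    exact key ξ hξ (isingH_le_of_comp hL hx)
  · obtain ⟨ξ, hξ, hx⟩ := exists_between_cnt hb hc
    exact key ξ hξ (isingH_le_of_comp hL fun x => (hx x).symm)

lemma res_minusC_notMem_Super (h2 : h < 1) (b : Bool) : res b (minusC L) ∉ Super h L := by
  have : comp h (res b (minusC L)) = minusC L := by
    funext x
    have he : ∀ x, ext (res b (minusC L)) x = false := fun x => by
      unfold ext; split_ifs <;> rfl
    unfold comp
    split_ifs
    · exact he x
    · simp only [nnS, he, minusC]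
      rw [decide_eq_false_iff_not]
      norm_num [spin]
      linarith
  rw [Super, Set.mem_ofPred_eq, this, cnt_minusC]
  unfold critN
  omega

lemma res_plusC_mem_Super (h0 : 0 < h) (hL : Even L) (hNL : critN h < L) (b : Bool) :
    res b (plusC L) ∈ Super h L := by
  have : comp h (res b (plusC L)) = plusC L := by
    funext x
    unfold comp
    split_ifs with hx
    · exact ext_res hx
    · have hx' : chessE L x = !b := by
        have : ¬ chessE L x = b := hx
        revert this; cases chessE L x <;> cases b <;> simp
      rw [nnS_ext_res hL _ hx']
      simp only [nnS, plusC]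
      norm_num [spin]
      linarith
  rw [Super, Set.mem_ofPred_eq, this, cnt_plusC]
  nlinarith

/-- The energy is bounded away from zero on the updates of the subcritical configurations. -/
lemma exists_pos_le_isingH_of_sub (h0 : 0 < h) (h1 : h < 1) (hL : Even L) (hNL : critN h < L) :
    ∃ c : ℝ, 0 < c ∧ ∀ (b : Bool) (σ : Config L), res b σ ∉ Super h L →
      res b σ ≠ res b (minusC L) → c ≤ isingH h σ := by
  have hpos : ∀ (b : Bool) (σ : Config L), res b σ ∉ Super h L →
      res b σ ≠ res b (minusC L) → 0 < isingH h σ := by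
    intro b σ hb hm
    have h2 := isingH_le_of_comp (h := h) hL (σ := σ) (b := b) fun x => Or.inr rfl
    simp only [Super, Set.mem_ofPred_eq, not_le] at hb
    have h3 : 1 ≤ cnt (comp h (res b σ)) := by
      by_contra hc
      refine hm (res_eq_res_iff.2 fun x hx => ?_)
      by_contra hne
      have hσx : σ x = true := by simpa [minusC] using hne
      refine hc (one_le_cnt (x := x) ?_)
      rw [comp, if_pos (show chessE L x = (res b σ).1 from hx), ext_res hx, hσx]
    exact (dropE_pos h0 h1 h3 hb.le).trans_le
      ((dropE_le_isingH h (by omega)).trans h2)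
  by_cases hne : (Finset.univ.filter fun σ : Config L => 0 < isingH h σ).Nonempty
  · obtain ⟨σ0, hσ0, hmin⟩ := Finset.exists_min_image _ (isingH h) hne
    refine ⟨isingH h σ0, (Finset.mem_filter.1 hσ0).2, fun b σ hb hm => hmin σ ?_⟩
    exact Finset.mem_filter.2 ⟨Finset.mem_univ _, hpos b σ hb hm⟩
  · refine ⟨1, one_pos, fun b σ hb hm => absurd ?_ hne⟩
    exact ⟨σ, Finset.mem_filter.2 ⟨Finset.mem_univ _, hpos b σ hb hm⟩⟩

end Landscape

section CopyBounds

variable {L : ℕ} [NeZero L] {h : ℝ}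

/-- The two restrictions of a configuration. -/
def resSet (σ : Config L) : Set (Half L) := Set.range fun b => res b σ

lemma exp_le_weight (hL : Even L) (β h : ℝ) (b : Bool) (σ : Config L) :
    Real.exp (-β * isingH h σ) ≤ weight β h (res b σ) := by
  rw [← weight_mul_copyP hL β h b σ]
  have hS := isStochastic_copyP β h (L := L)
  refine mul_le_of_le_one_right (weight_pos β h _).le ?_
  rw [← hS.sum_eq_one (res b σ)]
  exact Finset.single_le_sum (fun w _ => hS.nonneg _ w) (Finset.mem_univ (res (!b) σ))

lemma weight_mul_copyP_le (hL : Even L) {β : ℝ} (hβ : 0 ≤ β) {m : ℝ} {v w : Half L}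
    (hm : ∀ σ : Config L, res v.1 σ = v → res w.1 σ = w → m ≤ isingH h σ) :
    weight β h v * copyP β h v w ≤ Real.exp (-β * m) := by
  by_cases hvw : w.1 = !v.1
  · obtain ⟨σ, h1, h2⟩ := exists_res_eq hvw
    have h3 := hm σ h1.symm (by rw [hvw]; exact h2.symm)
    rw [h1, h2, weight_mul_copyP hL]
    exact Real.exp_le_exp.2 (by nlinarith)
  · rw [copyP, if_neg hvw, mul_zero]
    exact (Real.exp_pos _).le

lemma weight_le (hL : Even L) {β : ℝ} (hβ : 0 ≤ β) {m : ℝ} {v : Half L}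
    (hm : ∀ σ : Config L, res v.1 σ = v → m ≤ isingH h σ) :
    weight β h v ≤ Fintype.card (Half L) * Real.exp (-β * m) := by
  have hS := isStochastic_copyP β h (L := L)
  calc weight β h v = ∑ w, weight β h v * copyP β h v w := by
        rw [← Finset.mul_sum, hS.sum_eq_one, mul_one]
    _ ≤ ∑ _w : Half L, Real.exp (-β * m) :=
        Finset.sum_le_sum fun w _ => weight_mul_copyP_le hL hβ fun σ hσ _ => hm σ hσ
    _ = _ := by simp

/-- Upper bound for hitting times of one of the independent components, in terms of the heights of
the paths to the target. -/
lemma exists_mul_surv_copyP_le (hL : Even L) {A : Set (Half L)} {G : ℝ} (hG : 0 ≤ G)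
    (hA : ∀ y : Config L, ∃ a : Config L, res true a ∈ A ∧ Joined h (isingH h y + G) y a) :
    ∃ C : ℝ, 0 < C ∧ ∀ β : ℝ, 0 ≤ β → ∀ (n : ℕ) (v : Half L),
      n * surv (copyP β h) A n v ≤ C * Real.exp (β * G) := by
  choose a haA ha using hA
  choose ℓ hℓ using ha
  have hσ : ∀ v : Half L, ∃ σ : Config L, res v.1 σ = v ∧
      ∀ η : Config L, res v.1 η = v → isingH h σ ≤ isingH h η := by
    intro v
    obtain ⟨σ, hσ, hmin⟩ := Finset.exists_min_image
      (Finset.univ.filter fun σ : Config L => res v.1 σ = v) (isingH h) ⟨ext v, by simp [res_ext]⟩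
    exact ⟨σ, (Finset.mem_filter.1 hσ).2, fun η hη => hmin η (by simp [hη])⟩
  choose s hs hsmin using hσ
  set N : ℕ := ∑ y, ℓ y
  have hN : ∀ y, (ℓ y : ℝ) ≤ N := fun y => by
    exact_mod_cast Finset.single_le_sum (f := ℓ) (fun _ _ => Nat.zero_le _) (Finset.mem_univ y)
  refine ⟨2 * ((N : ℝ) + 1) ^ 2 * Fintype.card (Half L) * Fintype.card (Half L) + 1,
    by positivity, fun β hβ n v => ?_⟩
  have key := (isReversible_copyP hL β h).mul_surv_le (A := A) (ℓ := (N : ℝ) + 1)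
    (M := Fintype.card (Half L) * Real.exp (β * G))
    (κ := fun y => Real.exp (-β * (isingH h (s y) + G))) (fun y => Real.exp_pos _) ?_ ?_ n v
  · refine key.trans ?_
    have := Real.exp_pos (β * G)
    linarith
  · intro y f d hd hf
    have hedge : ∀ ξ : Config L, isingH h ξ ≤ isingH h (s y) + G →
        |f (res true ξ) - f (res false ξ)| ≤ d := by
      intro ξ hξ
      refine hf _ _ ?_
      have := weight_mul_copyP hL β h true ξ
      simp only [Bool.not_true] at this
      rw [this]
      exact Real.exp_le_exp.2 (by nlinarith)
    refine ⟨res true (a (s y)), haA _, ?_⟩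
    have h1 := hℓ (s y) f d hd hedge
    have h2 : |f y - f (res true (s y))| ≤ d := by
      have hsy := hs y
      cases hb : y.1
      · rw [hb] at hsy
        rw [← hsy, abs_sub_comm]
        simp only [hsy]
        have := hedge (s y) (by linarith)
        rwa [hsy] at this
      · rw [hb] at hsy
        rw [hsy]
        simpa using hd
    have h3 := abs_sub_le (f y) (f (res true (s y))) (f (res true (a (s y))))
    have h4 : (ℓ (s y) : ℝ) * d ≤ N * d := mul_le_mul_of_nonneg_right (hN _) hd
    linarith
  · intro y
    refine (weight_le hL hβ (hsmin y)).trans (le_of_eq ?_)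
    rw [mul_assoc, ← Real.exp_add]
    congr 2
    ring

/-- Estimates for one of the two independent components, uniformly in the inverse temperature. -/
structure CopyBounds (h : ℝ) (L : ℕ) [NeZero L] (C c Γ' : ℝ) : Prop where
  one_sub_surv_super : ∀ β : ℝ, 0 ≤ β → ∀ (b : Bool) (t : ℕ),
    1 - surv (copyP β h) (Super h L) t (res b (minusC L)) ≤ C * t * Real.exp (-(β * Gam h))
  leave_plus : ∀ β : ℝ, 0 ≤ β → ∀ (b : Bool) (t : ℕ),
    evalAt (copyP β h) t (ind (resSet (plusC L))ᶜ) (res b (plusC L)) ≤ C * Real.exp (-(β * c))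
  mul_surv_plus : ∀ β : ℝ, 0 ≤ β → ∀ (n : ℕ) (v : Half L),
    n * surv (copyP β h) (resSet (plusC L)) n v ≤ C * Real.exp (β * Gam h)
  mul_surv_hom : ∀ β : ℝ, 0 ≤ β → ∀ (n : ℕ) (v : Half L),
    n * surv (copyP β h) (resSet (minusC L) ∪ resSet (plusC L)) n v ≤ C * Real.exp (β * Γ')
  leave_minus : ∀ β : ℝ, 0 ≤ β → ∀ (b : Bool) (t : ℕ),
    evalAt (copyP β h) t (ind (Super h L ∪ resSet (minusC L))ᶜ) (res b (minusC L)) ≤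
      C * Real.exp (-(β * c))

lemma exists_leave_plus (h0 : 0 < h) (hL : Even L) : ∃ c : ℝ, 0 < c ∧
    ∀ β : ℝ, 0 ≤ β → ∀ (b : Bool) (t : ℕ),
      evalAt (copyP β h) t (ind (resSet (plusC L))ᶜ) (res b (plusC L)) ≤
        (Fintype.card (Half L) : ℝ) ^ 2 * Real.exp (-(β * c)) := by
  refine ⟨2 * h, by linarith, fun β hβ b t => ?_⟩
  have h1 := (isReversible_copyP hL β h).weight_mul_evalAt_le t
    (ind_nonneg (resSet (plusC L))ᶜ) (res b (plusC L))
  have h2 := exp_le_weight hL β h b (plusC L)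
  have h3 : ∑ v, weight β h v * ind (resSet (plusC L))ᶜ v ≤
      ∑ _v : Half L, Fintype.card (Half L) * Real.exp (-β * (isingH h (plusC L) + 2 * h)) := by
    refine Finset.sum_le_sum fun v _ => ?_
    by_cases hv : v ∈ resSet (plusC L)
    · rw [ind_of_notMem (by simpa using hv), mul_zero]
      positivity
    · rw [ind_of_mem (by simpa using hv), mul_one]
      refine weight_le hL hβ fun σ hσ => isingH_plusC_add_le h0 ?_
      rintro rfl
      exact hv ⟨_, hσ⟩
  rw [Finset.sum_const, Finset.card_univ, nsmul_eq_mul] at h3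
  have h4 : Real.exp (-β * isingH h (plusC L)) * evalAt (copyP β h) t (ind (resSet (plusC L))ᶜ)
      (res b (plusC L)) ≤ Real.exp (-β * isingH h (plusC L)) *
        ((Fintype.card (Half L) : ℝ) ^ 2 * Real.exp (-(β * (2 * h)))) := by
    refine (mul_le_mul_of_nonneg_right h2 ((isStochastic_copyP β h).evalAt_nonneg t
      (ind_nonneg _) _)).trans (h1.trans (h3.trans (le_of_eq ?_)))
    have : -β * (isingH h (plusC L) + 2 * h) = -β * isingH h (plusC L) + -(β * (2 * h)) := by ring
    rw [this, Real.exp_add]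
    ring
  exact le_of_mul_le_mul_left h4 (Real.exp_pos _)

lemma exists_leave_minus (h0 : 0 < h) (h1 : h < 1) (hL : Even L) (hNL : critN h < L) :
    ∃ c : ℝ, 0 < c ∧ ∀ β : ℝ, 0 ≤ β → ∀ (b : Bool) (t : ℕ),
      evalAt (copyP β h) t (ind (Super h L ∪ resSet (minusC L))ᶜ) (res b (minusC L)) ≤
        (Fintype.card (Half L) : ℝ) ^ 2 * Real.exp (-(β * c)) := by
  obtain ⟨c, hc, hcH⟩ := exists_pos_le_isingH_of_sub h0 h1 hL hNL
  refine ⟨c, hc, fun β hβ b t => ?_⟩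
  have h1 := (isReversible_copyP hL β h).weight_mul_evalAt_le t
    (ind_nonneg (Super h L ∪ resSet (minusC L))ᶜ) (res b (minusC L))
  have h2 := exp_le_weight hL β h b (minusC L)
  rw [isingH_minusC, mul_zero, Real.exp_zero] at h2
  have h3 : ∑ v, weight β h v * ind (Super h L ∪ resSet (minusC L))ᶜ v ≤
      ∑ _v : Half L, Fintype.card (Half L) * Real.exp (-β * c) := by
    refine Finset.sum_le_sum fun v _ => ?_
    by_cases hv : v ∈ Super h L ∪ resSet (minusC L)
    · rw [ind_of_notMem (Set.notMem_compl_iff.2 hv), mul_zero]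
      positivity
    · rw [ind_of_mem (by simpa using hv), mul_one]
      simp only [Set.mem_union, not_or] at hv
      refine weight_le hL hβ fun σ hσ => hcH v.1 σ (by rw [hσ]; exact hv.1) ?_
      rw [hσ]
      exact fun hm => hv.2 ⟨_, hm.symm⟩
  rw [Finset.sum_const, Finset.card_univ, nsmul_eq_mul] at h3
  have h4 := mul_le_mul_of_nonneg_right h2 ((isStochastic_copyP β h).evalAt_nonneg t
    (ind_nonneg (Super h L ∪ resSet (minusC L))ᶜ) (res b (minusC L)))
  rw [one_mul] at h4
  refine h4.trans (h1.trans (h3.trans (le_of_eq ?_)))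
  rw [neg_mul]
  ring

lemma one_sub_surv_super_le (h0 : 0 < h) (h1 : h < 1) (hL : Even L) (hNL : critN h < L)
    {β : ℝ} (hβ : 0 ≤ β) (b : Bool) (t : ℕ) :
    1 - surv (copyP β h) (Super h L) t (res b (minusC L)) ≤
      (Fintype.card (Half L) : ℝ) ^ 2 * t * Real.exp (-(β * Gam h)) := by
  have h2 := exp_le_weight hL β h b (minusC L)
  rw [isingH_minusC, mul_zero, Real.exp_zero] at h2
  refine ((isReversible_copyP hL β h).one_sub_surv_le (κ := Real.exp (-(β * Gam h)))
    (res_minusC_notMem_Super h1 b) ?_ (Real.exp_pos _).le t).trans (le_of_eq (by ring))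
  intro v hv w hw
  have h3 := weight_mul_copyP_le hL hβ (m := Gam h) (v := v) (w := w) fun σ hσ1 hσ2 =>
    Gam_le_isingH_of_cross h0 h1 hL hNL (b := v.1) (b' := w.1) (by rw [hσ1]; exact hv)
      (by rw [hσ2]; exact hw)
  rw [neg_mul] at h3
  exact h3.trans (le_mul_of_one_le_right (Real.exp_pos _).le h2)

/-- The bounds hold for small fields and large tori. -/
lemma exists_copyBounds (h0 : 0 < h) (h1 : h < 1) :
    ∃ (L₀ : ℕ) (Γ' : ℝ), critN h < L₀ ∧ 0 ≤ Γ' ∧ Γ' < Gam h ∧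
    ∀ (L : ℕ) [NeZero L], Even L → L₀ ≤ L → ∃ C c : ℝ, 1 ≤ C ∧ 0 < c ∧ CopyBounds h L C c Γ' := by
  obtain ⟨K, Γ', -, hNK, hΓ0, hΓ, hland⟩ := exists_landscape h0 h1
  refine ⟨K + 1, Γ', by omega, hΓ0, hΓ, fun L _ hL hKL => ?_⟩
  have hy := hland L (by omega)
  obtain ⟨c1, hc1, hb1⟩ := exists_leave_plus (L := L) h0 hL
  obtain ⟨c2, hc2, hb2⟩ := exists_leave_minus (L := L) h0 h1 hL (by omega)
  obtain ⟨C1, hC1, hb3⟩ := exists_mul_surv_copyP_le (A := resSet (plusC L)) hL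
    (hΓ0.trans hΓ.le) fun y => ⟨plusC L, ⟨true, rfl⟩, (hy y).2⟩
  obtain ⟨C2, hC2, hb4⟩ := exists_mul_surv_copyP_le
    (A := resSet (minusC L) ∪ resSet (plusC L)) hL hΓ0 fun y => by
      rcases (hy y).1 with hj | hj
      · exact ⟨minusC L, Or.inl ⟨true, rfl⟩, hj⟩
      · exact ⟨plusC L, Or.inr ⟨true, rfl⟩, hj⟩
  set C0 : ℝ := (Fintype.card (Half L) : ℝ) ^ 2
  have hC0 : 0 ≤ C0 := by positivity
  refine ⟨1 + C0 + C1 + C2, min c1 c2, by linarith, lt_min hc1 hc2, ?_, ?_, ?_, ?_, ?_⟩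
  · intro β hβ b t
    refine (one_sub_surv_super_le h0 h1 hL (by omega) hβ b t).trans ?_
    gcongr
    linarith
  · intro β hβ b t
    refine (hb1 β hβ b t).trans ?_
    gcongr
    · linarith
    · exact min_le_left _ _
  · intro β hβ n v
    refine (hb3 β hβ n v).trans ?_
    gcongr
    linarith
  · intro β hβ n v
    refine (hb4 β hβ n v).trans ?_
    gcongr
    linarith
  · intro β hβ b t
    refine (hb2 β hβ b t).trans ?_
    gcongr
    · linarith
    · exact min_le_right _ _

end CopyBounds

section HittingTimes

variable {L : ℕ} [NeZero L]

lemma firstHitP_zero (β h : ℝ) (D : Set (Config L)) (σ : Config L) :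
    firstHitP β h σ D Set.univ 0 = ind D σ := by
  unfold firstHitP
  rw [Fintype.sum_eq_single fun _ => σ]
  · simp [ind]
  · intro f hf
    rw [if_neg]
    rintro ⟨h1, -⟩
    refine hf (funext fun i => ?_)
    rw [show i = 0 from Fin.ext (by omega), h1]

lemma firstHitP_succ (β h : ℝ) (D : Set (Config L)) (σ : Config L) (n : ℕ) :
    firstHitP β h σ D Set.univ (n + 1) =
      ind Dᶜ σ * stepOp (Pmat β h) (fun η => firstHitP β h η D Set.univ n) σ := by
  have hR : ind Dᶜ σ * stepOp (Pmat β h) (fun η => firstHitP β h η D Set.univ n) σ =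
      ∑ g : Fin (n + 1) → Config L, if σ ∉ D ∧ (∀ i : Fin (n + 1), (i : ℕ) < n → g i ∉ D) ∧
        g (Fin.last n) ∈ D ∩ Set.univ
        then Pmat β h σ (g 0) * ∏ i : Fin n, Pmat β h (g i.castSucc) (g i.succ) else 0 := by
    simp only [stepOp, firstHitP, Finset.mul_sum]
    rw [Finset.sum_comm]
    refine Finset.sum_congr rfl fun g _ => ?_
    rw [Fintype.sum_eq_single (g 0)]
    · by_cases hσ : σ ∈ D
      · simp [ind, hσ]
      · by_cases hg : (∀ i : Fin (n + 1), (i : ℕ) < n → g i ∉ D) ∧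
          g (Fin.last n) ∈ D ∩ Set.univ
        · rw [if_pos ⟨rfl, hg⟩, if_pos ⟨hσ, hg⟩, ind_of_mem (by simpa using hσ), one_mul]
        · rw [if_neg fun hc => hg hc.2, if_neg fun hc => hg hc.2]
          simp
    · intro η hη
      rw [if_neg fun hc => hη hc.1.symm]
      simp
  rw [hR]
  unfold firstHitP
  rw [← (Fin.consEquiv fun _ : Fin (n + 1 + 1) => Config L).sum_comp, Fintype.sum_prod_type,
    Finset.sum_comm]
  refine Finset.sum_congr rfl fun g _ => ?_
  have hlast : ∀ a : Config L, (Fin.cons a g : Fin (n + 1 + 1) → Config L) (Fin.last (n + 1)) =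
      g (Fin.last n) := fun a => by rw [← Fin.succ_last, Fin.cons_succ]
  have hcond : ∀ a : Config L,
      (∀ i : Fin (n + 1 + 1), (i : ℕ) < n + 1 →
        (Fin.cons a g : Fin (n + 1 + 1) → Config L) i ∉ D) ↔
      a ∉ D ∧ ∀ i : Fin (n + 1), (i : ℕ) < n → g i ∉ D := by
    intro a
    rw [Fin.forall_fin_succ]
    simp
  have hprod : ∀ a : Config L, ∏ i : Fin (n + 1),
      Pmat β h ((Fin.cons a g : Fin (n + 1 + 1) → Config L) i.castSucc)
        ((Fin.cons a g : Fin (n + 1 + 1) → Config L) i.succ) =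
      Pmat β h a (g 0) * ∏ i : Fin n, Pmat β h (g i.castSucc) (g i.succ) := by
    intro a
    rw [Fin.prod_univ_succ]
    simp
  simp only [Fin.consEquiv_apply, hlast, hcond, hprod, Fin.cons_zero]
  rw [Fintype.sum_eq_single σ]
  · simp [and_assoc]
  · intro a ha
    rw [if_neg fun hc => ha hc.1]

lemma firstHitP_nonneg {β h : ℝ} (hS : IsStochastic (Pmat β h : Config L → Config L → ℝ))
    (D : Set (Config L)) (σ : Config L) (n : ℕ) : 0 ≤ firstHitP β h σ D Set.univ n := by
  unfold firstHitP
  refine Finset.sum_nonneg fun f _ => ?_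
  split_ifs
  · exact Finset.prod_nonneg fun i _ => hS.nonneg _ _
  · exact le_rfl

variable {β h : ℝ} (hS : IsStochastic (Pmat β h : Config L → Config L → ℝ))
include hS

lemma sum_firstHitP (D : Set (Config L)) (n : ℕ) (σ : Config L) :
    ∑ k ∈ Finset.range (n + 1), firstHitP β h σ D Set.univ k = 1 - surv (Pmat β h) D n σ := by
  induction n generalizing σ with
  | zero =>
    rw [Finset.sum_range_one, firstHitP_zero]
    show _ = 1 - ind Dᶜ σ
    rw [ind_compl]; ring
  | succ n ih =>
    rw [Finset.sum_range_succ', firstHitP_zero, surv_succ]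
    simp only [firstHitP_succ]
    rw [← Finset.mul_sum, ← stepOp_sum]
    simp only [ih]
    have h1 : stepOp (Pmat β h) (fun η => 1 - surv (Pmat β h) D n η) σ =
        1 - stepOp (Pmat β h) (surv (Pmat β h) D n) σ := by
      simp only [stepOp, mul_sub, mul_one, Finset.sum_sub_distrib, hS.sum_eq_one]
    rw [h1, ind_compl]
    ring

omit hS in
lemma probTauIn_Ioo_eq (D : Set (Config L)) (σ : Config L) {a b : ℝ} {N : ℕ} (hN : b ≤ N) :
    probTauIn β h σ D (Set.Ioo a b) =
      ∑ k ∈ Finset.range (N + 1), if (k : ℝ) ∈ Set.Ioo a b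
        then firstHitP β h σ D Set.univ k else 0 := by
  unfold probTauIn
  have h0 : ∀ k ∉ Finset.range (N + 1), (if (k : ℝ) ∈ Set.Ioo a b
      then firstHitP β h σ D Set.univ k else 0) = 0 := by
    intro k hk
    refine if_neg fun hk' => hk ?_
    have : (k : ℝ) < N := hk'.2.trans_le hN
    have : k < N := by exact_mod_cast this
    exact Finset.mem_range.2 (by omega)
  convert tsum_eq_sum (L := SummationFilter.unconditional ℕ) h0

lemma probTauIn_Ioo_le_one (D : Set (Config L)) (σ : Config L) (a b : ℝ) :
    probTauIn β h σ D (Set.Ioo a b) ≤ 1 := by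
  rw [probTauIn_Ioo_eq D σ (Nat.le_ceil b)]
  calc _ ≤ ∑ k ∈ Finset.range (⌈b⌉₊ + 1), firstHitP β h σ D Set.univ k := by
        refine Finset.sum_le_sum fun k _ => ?_
        split_ifs
        · exact le_rfl
        · exact firstHitP_nonneg hS D σ k
    _ ≤ 1 := by
        rw [sum_firstHitP hS]
        linarith [hS.surv_nonneg D ⌈b⌉₊ σ]

lemma surv_sub_surv_le_probTauIn (D : Set (Config L)) (σ : Config L) {a b : ℝ} {s t : ℕ}
    (hs : a < s + 1) (ht : (t : ℝ) < b) :
    surv (Pmat β h) D s σ - surv (Pmat β h) D t σ ≤ probTauIn β h σ D (Set.Ioo a b) := by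
  have hnn := firstHitP_nonneg hS D σ
  have e1 := sum_firstHitP hS D s σ
  have e2 := sum_firstHitP hS D t σ
  rw [probTauIn_Ioo_eq D σ (Nat.le_ceil b)]
  have htN : t + 1 ≤ ⌈b⌉₊ + 1 := by
    have := ht.trans_le (Nat.le_ceil b)
    have : t < ⌈b⌉₊ := by exact_mod_cast this
    omega
  have h1 : ∑ k ∈ Finset.range (t + 1), (if (k : ℝ) ∈ Set.Ioo a b
        then firstHitP β h σ D Set.univ k else 0) ≤
      ∑ k ∈ Finset.range (⌈b⌉₊ + 1), if (k : ℝ) ∈ Set.Ioo a b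
        then firstHitP β h σ D Set.univ k else 0 :=
    Finset.sum_le_sum_of_subset_of_nonneg (Finset.range_mono htN) fun k _ _ => by
      split_ifs
      · exact hnn k
      · exact le_rfl
  have h2 : ∑ k ∈ Finset.range (t + 1), firstHitP β h σ D Set.univ k ≤
      ∑ k ∈ Finset.range (t + 1), (if (k : ℝ) ∈ Set.Ioo a b
        then firstHitP β h σ D Set.univ k else 0) +
      ∑ k ∈ Finset.range (s + 1), firstHitP β h σ D Set.univ k := by
    have h3 : ∑ k ∈ Finset.range (t + 1), firstHitP β h σ D Set.univ k ≤
        ∑ k ∈ Finset.range (t + 1), ((if (k : ℝ) ∈ Set.Ioo a b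
          then firstHitP β h σ D Set.univ k else 0) +
          if k ∈ Finset.range (s + 1) then firstHitP β h σ D Set.univ k else 0) := by
      refine Finset.sum_le_sum fun k hk => ?_
      have := hnn k
      by_cases hks : k ∈ Finset.range (s + 1)
      · rw [if_pos hks]
        split_ifs <;> linarith
      · have hk1 : (k : ℝ) ∈ Set.Ioo a b := by
          rw [Finset.mem_range, not_lt] at hks
          rw [Finset.mem_range] at hk
          have a1 : (s : ℝ) + 1 ≤ k := by exact_mod_cast hks
          have a2 : (k : ℝ) ≤ t := by exact_mod_cast (by omega : k ≤ t)
          exact ⟨by linarith, by linarith⟩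
        rw [if_pos hk1, if_neg hks, add_zero]
    rw [Finset.sum_add_distrib] at h3
    refine h3.trans (add_le_add_right ?_ _)
    rw [← Finset.sum_filter]
    exact Finset.sum_le_sum_of_subset_of_nonneg
      (fun k hk => (Finset.mem_filter.1 hk).2) fun k _ _ => hnn k
  linarith

end HittingTimes

section FromMinus

lemma IsStochastic.pow_evalAt_singleton_le {V : Type*} [Fintype V] {P : V → V → ℝ}
    (hP : IsStochastic P) (x : V) (n k : ℕ) :
    evalAt P n (ind {x}) x ^ k ≤ evalAt P (k * n) (ind {x}) x := by
  induction k with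
  | zero => simp [evalAt, ind]
  | succ k ih =>
    have h0 : 0 ≤ evalAt P n (ind {x}) x := hP.evalAt_nonneg n (ind_nonneg _) x
    have h1 : ∀ v, evalAt P n (ind {x}) x * ind {x} v ≤ evalAt P n (ind {x}) v := by
      intro v
      by_cases hv : v = x
      · subst hv; rw [ind_of_mem (Set.mem_singleton v), mul_one]
      · rw [ind_of_notMem (by simpa using hv), mul_zero]
        exact hP.evalAt_nonneg n (ind_nonneg _) v
    have h2 := hP.evalAt_mono (k * n) h1 x
    rw [evalAt_smul, ← evalAt_add_time] at h2
    rw [pow_succ', Nat.succ_mul]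
    exact (mul_le_mul_of_nonneg_left ih h0).trans h2

lemma IsStochastic.evalAt_ind_le_one_sub_surv {V : Type*} [Fintype V] {P : V → V → ℝ}
    (hP : IsStochastic P) {A W : Set V} (hAW : A ⊆ W) (n : ℕ) (u : V) :
    evalAt P n (ind A) u ≤ 1 - surv P W n u := by
  have h1 : evalAt P n (ind A) u ≤ evalAt P n (ind W) u := by
    refine hP.evalAt_mono n (fun v => ?_) u
    by_cases hv : v ∈ A
    · rw [ind_of_mem hv, ind_of_mem (hAW hv)]
    · rw [ind_of_notMem hv]; exact ind_nonneg _ _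
  have h2 := hP.surv_le_evalAt W n u
  rw [hP.evalAt_ind_compl] at h2
  linarith

variable {L : ℕ} [NeZero L] {h : ℝ}

omit [NeZero L] in
lemma res_mem_resSet_iff {b : Bool} {σ η : Config L} :
    res b σ ∈ resSet η ↔ res b σ = res b η := by
  constructor
  · rintro ⟨c, hc⟩
    have : c = b := congrArg Sigma.fst hc
    rw [← hc, this]
  · intro hb
    exact ⟨b, hb.symm⟩

omit [NeZero L] in
lemma ind_plusC_eq_tens :
    ind {plusC L} = tens (ind (resSet (plusC L))) (ind (resSet (plusC L))) := by
  funext σ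
  unfold tens
  by_cases h1 : res true σ = res true (plusC L) <;> by_cases h2 : res false σ = res false (plusC L)
  · rw [ind_of_mem (res_mem_resSet_iff.2 h1), ind_of_mem (res_mem_resSet_iff.2 h2),
      ind_of_mem (show σ ∈ {plusC L} from eq_of_res_eq h1 h2), one_mul]
  · rw [ind_of_notMem (A := resSet _) (fun hc => h2 (res_mem_resSet_iff.1 hc)), mul_zero,
      ind_of_notMem]
    rintro rfl; exact h2 rfl
  · rw [ind_of_notMem (A := resSet _) (fun hc => h1 (res_mem_resSet_iff.1 hc)), zero_mul,
      ind_of_notMem]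
    rintro rfl; exact h1 rfl
  · rw [ind_of_notMem (A := resSet _) (fun hc => h1 (res_mem_resSet_iff.1 hc)), zero_mul,
      ind_of_notMem]
    rintro rfl; exact h1 rfl

omit [NeZero L] in
lemma res_chessE (b : Bool) :
    res b (chessE L) = res b (if b then plusC L else minusC L) := by
  refine res_eq_res_iff.2 fun x hx => ?_
  cases b <;> simpa [plusC, minusC] using hx

omit [NeZero L] in
lemma res_chessO (b : Bool) :
    res b (chessO L) = res b (if b then minusC L else plusC L) := by
  refine res_eq_res_iff.2 fun x hx => ?_
  cases b <;> simpa [plusC, minusC, chessO] using hx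

omit [NeZero L] in
/-- A configuration that is homogeneous on both sublattices is a chessboard, all-minus or
all-plus. -/
lemma mem_of_res_mem {σ : Config L}
    (hσ : ∀ b, res b σ ∈ resSet (minusC L) ∪ resSet (plusC L)) :
    σ ∈ chessSet L ∨ σ = minusC L ∨ σ = plusC L := by
  rcases hσ true with h1 | h1 <;> rcases hσ false with h2 | h2 <;>
    rw [res_mem_resSet_iff] at h1 h2
  · exact Or.inr (Or.inl (eq_of_res_eq h1 h2))
  · refine Or.inl (Or.inr (eq_of_res_eq (b := true) ?_ ?_))
    · rw [h1, res_chessO]; rfl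
    · rw [Bool.not_true, h2, res_chessO]; rfl
  · refine Or.inl (Or.inl (eq_of_res_eq (b := true) ?_ ?_))
    · rw [h1, res_chessE]; rfl
    · rw [Bool.not_true, h2, res_chessE]; rfl
  · exact Or.inr (Or.inr (eq_of_res_eq h1 h2))

/-- One block of time of length `n` for the hitting time of the chessboards. -/
lemma surv_chessSet_add_le (hL : Even L) (β : ℝ) {q r : ℝ} (n k : ℕ)
    (hq : ∀ b, evalAt (copyP β h) n (ind (resSet (minusC L) ∪ resSet (plusC L))ᶜ)
      (res b (minusC L)) ≤ q)
    (hr : ∀ b, evalAt (copyP β h) n (ind (resSet (plusC L))) (res b (minusC L)) ≤ r) :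
    surv (Pmat β h) (chessSet L) (n + k) (minusC L) ≤
      evalAt (Pmat β h) n (ind {minusC L}) (minusC L) *
        surv (Pmat β h) (chessSet L) k (minusC L) + (2 * q + r ^ 2) := by
  have hS := isStochastic_Pmat (L := L) hL β h
  have hV := isStochastic_copyP (L := L) β h
  set B := resSet (minusC L) ∪ resSet (plusC L) with hB
  set S := surv (Pmat β h) (chessSet L) k (minusC L) with hS'
  have hS0 : 0 ≤ S := hS.surv_nonneg _ _ _
  have hpt : ∀ v, surv (Pmat β h) (chessSet L) k v ≤
      (S * ind {minusC L} v + tens (ind (resSet (plusC L))) (ind (resSet (plusC L))) v) +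
        (tens (ind Bᶜ) (fun _ => 1) v + tens (fun _ => 1) (ind Bᶜ) v) := by
    intro v
    have a1 : 0 ≤ S * ind {minusC L} v := mul_nonneg hS0 (ind_nonneg _ _)
    have a2 : 0 ≤ tens (ind (resSet (plusC L))) (ind (resSet (plusC L))) v :=
      mul_nonneg (ind_nonneg _ _) (ind_nonneg _ _)
    have a3 : 0 ≤ tens (ind Bᶜ) (fun _ => 1) v := mul_nonneg (ind_nonneg _ _) zero_le_one
    have a4 : 0 ≤ tens (fun _ => 1) (ind Bᶜ) v := mul_nonneg zero_le_one (ind_nonneg _ _)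
    have a5 := hS.surv_le_one (chessSet L) k v
    by_cases hv : ∀ b, res b v ∈ B
    · rcases mem_of_res_mem hv with hc | rfl | rfl
      · rw [IsStochastic.surv_of_mem hc]; linarith
      · rw [ind_of_mem (Set.mem_singleton _), mul_one]; linarith
      · have : tens (ind (resSet (plusC L))) (ind (resSet (plusC L))) (plusC L) = 1 := by
          rw [← ind_plusC_eq_tens]; exact ind_of_mem (Set.mem_singleton _)
        linarith
    · push Not at hv
      obtain ⟨b, hb⟩ := hv
      have hb1 : ind Bᶜ (res b v) = 1 := ind_of_mem hb
      cases b
      · have : tens (fun _ => 1) (ind Bᶜ) v = 1 := by simp [tens, hb1]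
        linarith
      · have : tens (ind Bᶜ) (fun _ => 1) v = 1 := by simp [tens, hb1]
        linarith
  refine (hS.surv_add_le _ n k _).trans ((hS.evalAt_mono n hpt _).trans ?_)
  rw [evalAt_add, evalAt_add, evalAt_add, evalAt_smul]
  beta_reduce
  obtain ⟨b1, h1⟩ := evalAt_Pmat_tens hL β h (ind (resSet (plusC L))) (ind (resSet (plusC L))) n
  obtain ⟨b2, h2⟩ := evalAt_Pmat_tens hL β h (ind Bᶜ) (fun _ => 1) n
  obtain ⟨b3, h3⟩ := evalAt_Pmat_tens hL β h (fun _ => 1) (ind Bᶜ) n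
  rw [h1, h2, h3, hV.evalAt_const]
  have hr0 : ∀ b, 0 ≤ evalAt (copyP β h) n (ind (resSet (plusC L))) (res b (minusC L)) :=
    fun b => hV.evalAt_nonneg n (ind_nonneg _) _
  have := mul_le_mul (hr b1) (hr (!b1)) (hr0 _) ((hr0 b1).trans (hr b1))
  nlinarith [hq b2, hq (!b3)]

/-- Iteration of the block estimate. -/
lemma surv_chessSet_mul_le (hL : Even L) (β : ℝ) {q r : ℝ} (n : ℕ)
    (hq : ∀ b, evalAt (copyP β h) n (ind (resSet (minusC L) ∪ resSet (plusC L))ᶜ)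
      (res b (minusC L)) ≤ q)
    (hr : ∀ b, evalAt (copyP β h) n (ind (resSet (plusC L))) (res b (minusC L)) ≤ r) (k : ℕ) :
    surv (Pmat β h) (chessSet L) (k * n) (minusC L) ≤
      evalAt (Pmat β h) (k * n) (ind {minusC L}) (minusC L) + k * (2 * q + r ^ 2) := by
  have hS := isStochastic_Pmat (L := L) hL β h
  have hq0 : 0 ≤ q := ((isStochastic_copyP β h).evalAt_nonneg n (ind_nonneg _) _).trans (hq true)
  set ρ := evalAt (Pmat β h) n (ind {minusC L}) (minusC L)
  have hρ0 : 0 ≤ ρ := hS.evalAt_nonneg n (ind_nonneg _) _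
  have hρ1 : ρ ≤ 1 := hS.evalAt_ind_le_one n _ _
  have hbad : 0 ≤ 2 * q + r ^ 2 := by positivity
  suffices hk : surv (Pmat β h) (chessSet L) (k * n) (minusC L) ≤ ρ ^ k + k * (2 * q + r ^ 2) by
    linarith [hS.pow_evalAt_singleton_le (minusC L) n k]
  induction k with
  | zero => simpa using hS.surv_le_one _ _ _
  | succ k ih =>
    have h1 := surv_chessSet_add_le hL β n (k * n) hq hr
    have h2 := mul_le_mul_of_nonneg_left ih hρ0
    have h3 : ρ * (k * (2 * q + r ^ 2)) ≤ k * (2 * q + r ^ 2) :=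
      mul_le_of_le_one_left (by positivity) hρ1
    rw [Nat.succ_mul, add_comm (k * n), pow_succ']
    push_cast
    linarith

lemma one_sub_le_surv (hL : Even L) {β : ℝ} {p : ℝ} (n : ℕ) {D : Set (Config L)}
    (hD : D ⊆ {σ | res true σ ∈ Super h L ∨ res false σ ∈ Super h L})
    (hp : ∀ b, 1 - surv (copyP β h) (Super h L) n (res b (minusC L)) ≤ p) :
    1 - 2 * p ≤ surv (Pmat β h) D n (minusC L) := by
  have hV := isStochastic_copyP (L := L) β h
  have h1 := (isStochastic_Pmat hL β h).surv_anti_set hD n (minusC L)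
  rw [surv_Pmat hL] at h1
  refine le_trans ?_ h1
  unfold tens
  have a1 := hp true
  have a2 := hp false
  have a3 := hV.surv_le_one (Super h L) n (res true (minusC L))
  have a4 := hV.surv_le_one (Super h L) n (res false (minusC L))
  nlinarith

lemma one_sub_evalAt_plusC_le (hL : Even L) {β : ℝ} {p : ℝ} (n : ℕ)
    (hp : ∀ b, evalAt (copyP β h) n (ind (resSet (plusC L))ᶜ) (res b (minusC L)) ≤ p) :
    1 - evalAt (Pmat β h) n (ind {plusC L}) (minusC L) ≤ 2 * p := by
  have hV := isStochastic_copyP (L := L) β h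
  rw [ind_plusC_eq_tens]
  obtain ⟨b, hb⟩ := evalAt_Pmat_tens hL β h (ind (resSet (plusC L))) (ind (resSet (plusC L))) n
  rw [hb]
  have a1 := hp b
  have a2 := hp (!b)
  rw [hV.evalAt_ind_compl] at a1 a2
  have a3 := hV.evalAt_ind_le_one n (resSet (plusC L)) (res b (minusC L))
  have a4 := hV.evalAt_ind_le_one n (resSet (plusC L)) (res (!b) (minusC L))
  nlinarith

end FromMinus

section HittingTimeBounds

variable {L : ℕ} [NeZero L] {h C c Γ' : ℝ}

lemma natCeil_exp_le {x : ℝ} (hx : 0 ≤ x) : (⌈Real.exp x⌉₊ : ℝ) ≤ 2 * Real.exp x := by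
  have h1 := Nat.ceil_lt_add_one (Real.exp_pos x).le
  have h2 := Real.one_le_exp hx
  linarith

lemma CopyBounds.evalAt_resSet_plusC_le (hB : CopyBounds h L C c Γ') (hL : Even L) (h0 : 0 < h)
    (hNL : critN h < L) {β : ℝ} (hβ : 0 ≤ β) (b : Bool) (t : ℕ) :
    evalAt (copyP β h) t (ind (resSet (plusC L))) (res b (minusC L)) ≤
      C * t * Real.exp (-(β * Gam h)) := by
  refine ((isStochastic_copyP β h).evalAt_ind_le_one_sub_surv ?_ t _).trans
    (hB.one_sub_surv_super β hβ b t)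
  rintro _ ⟨b, rfl⟩
  exact res_plusC_mem_Super h0 hL hNL b

lemma CopyBounds.evalAt_resSet_plusC_compl_le (hB : CopyBounds h L C c Γ') (hC : 0 ≤ C) {β : ℝ}
    (hβ : 0 ≤ β) (v : Half L) (t : ℕ) :
    evalAt (copyP β h) t (ind (resSet (plusC L))ᶜ) v ≤
      surv (copyP β h) (resSet (plusC L)) t v + C * Real.exp (-(β * c)) := by
  refine (isStochastic_copyP β h).evalAt_ind_compl_le_surv_add ?_ (by positivity) v
  rintro _ ⟨b, rfl⟩ s -
  exact hB.leave_plus β hβ b s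

/-- At a time large enough for reaching the homogeneous states, the chain sits in one of them,
up to the probability of crossing the barrier or of being found excited. -/
lemma CopyBounds.evalAt_hom_compl_le (hB : CopyBounds h L C c Γ') (hC : 0 ≤ C) {β : ℝ}
    (hβ : 0 ≤ β) (v : Half L) (t : ℕ) :
    evalAt (copyP β h) t (ind (resSet (minusC L) ∪ resSet (plusC L))ᶜ) v ≤
      surv (copyP β h) (resSet (minusC L) ∪ resSet (plusC L)) t v +
        (C * Real.exp (-(β * c)) + C * t * Real.exp (-(β * Gam h))) := by
  have hV := isStochastic_copyP (L := L) β h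
  refine hV.evalAt_ind_compl_le_surv_add ?_ (by positivity) v
  rintro w hw s hst
  have hpos : 0 ≤ C * t * Real.exp (-(β * Gam h)) := by positivity
  rcases hw with ⟨b, rfl⟩ | ⟨b, rfl⟩
  · have h1 : ∀ u, ind (resSet (minusC L) ∪ resSet (plusC L))ᶜ u ≤
        ind (Super h L ∪ resSet (minusC L))ᶜ u + ind (Super h L) u := by
      intro u
      have a1 := ind_nonneg (Super h L) u
      have a2 := ind_nonneg (Super h L ∪ resSet (minusC L))ᶜ u
      by_cases hu : u ∈ resSet (minusC L) ∪ resSet (plusC L)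
      · rw [ind_of_notMem (Set.notMem_compl_iff.2 hu)]; linarith
      · rw [ind_of_mem (Set.mem_compl hu)]
        by_cases hs : u ∈ Super h L
        · rw [ind_of_mem hs]; linarith
        · rw [ind_of_mem (A := (Super h L ∪ resSet (minusC L))ᶜ)]
          · linarith
          · rintro (hs' | hs')
            · exact hs hs'
            · exact hu (Or.inl hs')
    have h2 := hV.evalAt_mono s h1 (res b (minusC L))
    rw [evalAt_add] at h2
    have h3 := hV.evalAt_ind_le_one_sub_surv (subset_refl (Super h L)) s (res b (minusC L))
    have h4 := hB.one_sub_surv_super β hβ b s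
    have h5 := hB.leave_minus β hβ b s
    have h6 : C * s * Real.exp (-(β * Gam h)) ≤ C * t * Real.exp (-(β * Gam h)) := by
      gcongr
    linarith
  · have h1 := hV.evalAt_mono s (f := ind (resSet (minusC L) ∪ resSet (plusC L))ᶜ)
      (g := ind (resSet (plusC L))ᶜ) (fun u => by
        by_cases hu : u ∈ resSet (plusC L)
        · rw [ind_of_notMem (Set.notMem_compl_iff.2 (Set.mem_union_right _ hu))]
          exact ind_nonneg _ _
        · rw [ind_of_mem (Set.mem_compl hu)]; exact ind_le_one _ _) (res b (plusC L))
    exact (h1.trans (hB.leave_plus β hβ b s)).trans (by linarith)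

/-- Both the chessboards and the all-plus configuration have been visited at a time slightly
larger than `exp (β Γ)`, with large probability. -/
lemma CopyBounds.exists_surv_le (hB : CopyBounds h L C c Γ') (hL : Even L) (h0 : 0 < h)
    (hNL : critN h < L) (hC : 1 ≤ C) {β δ : ℝ} (hβ : 0 ≤ β) (hδ : 0 < δ)
    (hΓ'0 : 0 ≤ Γ') (hΓ' : Γ' + 10 * δ ≤ Gam h) (hc : 10 * δ ≤ c) :
    ∃ t : ℕ, (t : ℝ) ≤ 4 * Real.exp (β * Gam h + β * δ) ∧
      surv (Pmat β h) {plusC L} t (minusC L) ≤ 28 * C ^ 2 * Real.exp (-(β * δ)) ∧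
      surv (Pmat β h) (chessSet L) t (minusC L) ≤ 28 * C ^ 2 * Real.exp (-(β * δ)) := by
  have hS := isStochastic_Pmat (L := L) hL β h
  have hV := isStochastic_copyP (L := L) β h
  have hC0 : 0 ≤ C := by linarith
  have hC2 : C ≤ C ^ 2 := by nlinarith
  have hβδ : 0 ≤ β * δ := by positivity
  have hβΓ' : 0 ≤ β * Γ' := by positivity
  have hβΓ : β * Γ' + 10 * (β * δ) ≤ β * Gam h := by
    have := mul_le_mul_of_nonneg_left hΓ' hβ; linarith
  have hβc : 10 * (β * δ) ≤ β * c := by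
    have := mul_le_mul_of_nonneg_left hc hβ; linarith
  set z : ℝ := Real.exp (-(β * δ)) with hz
  have hz0 : 0 < z := Real.exp_pos _
  have hz1 : z ≤ 1 := Real.exp_le_one_iff.2 (by linarith)
  set W : ℕ := ⌈Real.exp (β * Gam h - 2 * (β * δ))⌉₊ with hW
  set W' : ℕ := ⌈Real.exp (β * Gam h - 4 * (β * δ))⌉₊ with hW'
  set K : ℕ := ⌈Real.exp (3 * (β * δ))⌉₊ with hK
  have hWle : (W : ℝ) ≤ 2 * Real.exp (β * Gam h - 2 * (β * δ)) := natCeil_exp_le (by linarith)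
  have hW'le : (W' : ℝ) ≤ 2 * Real.exp (β * Gam h - 4 * (β * δ)) := natCeil_exp_le (by linarith)
  have hKle : (K : ℝ) ≤ 2 * Real.exp (3 * (β * δ)) := natCeil_exp_le (by linarith)
  have hWge : Real.exp (β * Gam h - 2 * (β * δ)) ≤ W := Nat.le_ceil _
  have hW'ge : Real.exp (β * Gam h - 4 * (β * δ)) ≤ W' := Nat.le_ceil _
  have hKge : Real.exp (3 * (β * δ)) ≤ K := Nat.le_ceil _
  have hW'W : W' ≤ W := Nat.ceil_mono (Real.exp_le_exp.2 (by linarith))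
  have ez : ∀ n : ℕ, z ^ n = Real.exp (-(n * (β * δ))) := fun n => by
    rw [hz, ← Real.exp_nat_mul]; congr 1; ring
  have ecz : Real.exp (-(β * c)) ≤ z ^ 10 := by
    rw [ez]; push_cast; exact Real.exp_le_exp.2 (by linarith)
  have z4 : z ^ 10 ≤ z ^ 4 := pow_le_pow_of_le_one hz0.le hz1 (by norm_num)
  have z6 : z ^ 6 ≤ z ^ 4 := pow_le_pow_of_le_one hz0.le hz1 (by norm_num)
  have z10 : z ^ 10 ≤ z := by
    simpa using pow_le_pow_of_le_one hz0.le hz1 (show 1 ≤ 10 by norm_num)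
  have eW : (W : ℝ) * Real.exp (-(β * Gam h)) ≤ 2 * z ^ 2 := by
    calc _ ≤ 2 * Real.exp (β * Gam h - 2 * (β * δ)) * Real.exp (-(β * Gam h)) := by gcongr
      _ = _ := by rw [ez, mul_assoc, ← Real.exp_add]; push_cast; congr 2; ring
  have eW' : (W' : ℝ) * Real.exp (-(β * Gam h)) ≤ 2 * z ^ 4 := by
    calc _ ≤ 2 * Real.exp (β * Gam h - 4 * (β * δ)) * Real.exp (-(β * Gam h)) := by gcongr
      _ = _ := by rw [ez, mul_assoc, ← Real.exp_add]; push_cast; congr 2; ring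
  have eKz : (K : ℝ) * z ^ 4 ≤ 2 * z := by
    calc _ ≤ 2 * Real.exp (3 * (β * δ)) * z ^ 4 := by gcongr
      _ = _ := by rw [ez, hz, mul_assoc, ← Real.exp_add]; push_cast; congr 2; ring
  have hTge : Real.exp (β * Gam h) ≤ z * (K * W : ℕ) := by
    push_cast
    calc Real.exp (β * Gam h) =
          z * (Real.exp (3 * (β * δ)) * Real.exp (β * Gam h - 2 * (β * δ))) := by
            rw [hz, ← Real.exp_add, ← Real.exp_add]; congr 1; ring
      _ ≤ _ := by gcongr
  have hTpos : (0 : ℝ) < (K * W : ℕ) := by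
    have := (Real.exp_pos (β * Gam h)).trans_le hTge
    exact pos_of_mul_pos_right this hz0.le
  have hplus : 1 - evalAt (Pmat β h) (K * W) (ind {plusC L}) (minusC L) ≤ 4 * C * z := by
    refine (one_sub_evalAt_plusC_le hL (K * W) (p := 2 * C * z) fun b => ?_).trans
      (by linarith)
    have a1 := hB.evalAt_resSet_plusC_compl_le hC0 hβ (res b (minusC L)) (K * W)
    have a2 := hB.mul_surv_plus β hβ (K * W) (res b (minusC L))
    have a3 : surv (copyP β h) (resSet (plusC L)) (K * W) (res b (minusC L)) ≤ C * z := by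
      have a4 : C * Real.exp (β * Gam h) ≤ (K * W : ℕ) * (C * z) := by
        calc _ ≤ C * (z * (K * W : ℕ)) := by gcongr
          _ = _ := by ring
      exact le_of_mul_le_mul_left (a2.trans a4) hTpos
    have a5 : C * Real.exp (-(β * c)) ≤ C * z := by
      gcongr; exact ecz.trans z10
    linarith
  have hsurvhom : ∀ v, surv (copyP β h) (resSet (minusC L) ∪ resSet (plusC L)) W' v ≤
      C * z ^ 4 := by
    intro v
    have a1 := hB.mul_surv_hom β hβ W' v
    have a2 : C * Real.exp (β * Γ') ≤ W' * (C * z ^ 6) := by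
      calc C * Real.exp (β * Γ') ≤
            C * (Real.exp (β * Gam h - 4 * (β * δ)) * z ^ 6) := by
              rw [ez, ← Real.exp_add]
              gcongr
              push_cast
              linarith
        _ ≤ C * (W' * z ^ 6) := by gcongr
        _ = _ := by ring
    have a3 := le_of_mul_le_mul_left (a1.trans a2) ((Real.exp_pos _).trans_le hW'ge)
    exact a3.trans (by gcongr)
  have hq : ∀ b, evalAt (copyP β h) W (ind (resSet (minusC L) ∪ resSet (plusC L))ᶜ)
      (res b (minusC L)) ≤ 4 * C * z ^ 4 := by
    intro b
    rw [← Nat.sub_add_cancel hW'W, evalAt_add_time]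
    refine hV.evalAt_le _ (fun v => ?_) _
    have a1 := hB.evalAt_hom_compl_le hC0 hβ v W'
    have a2 := hsurvhom v
    have a3 : C * Real.exp (-(β * c)) ≤ C * z ^ 4 := by
      gcongr; exact ecz.trans z4
    have a4 : C * W' * Real.exp (-(β * Gam h)) ≤ C * (2 * z ^ 4) := by
      rw [mul_assoc]; gcongr
    linarith
  have hr : ∀ b, evalAt (copyP β h) W (ind (resSet (plusC L))) (res b (minusC L)) ≤
      2 * C * z ^ 2 := by
    intro b
    refine (hB.evalAt_resSet_plusC_le hL h0 hNL hβ b W).trans ?_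
    rw [mul_assoc C, mul_comm 2 C, mul_assoc C]
    gcongr
  have hCz : C * z ≤ C ^ 2 * z := by gcongr
  refine ⟨K * W, ?_, ?_, ?_⟩
  · push_cast
    calc (K : ℝ) * W ≤ (2 * Real.exp (3 * (β * δ))) * (2 * Real.exp (β * Gam h - 2 * (β * δ))) := by
          gcongr
      _ = 4 * (Real.exp (3 * (β * δ)) * Real.exp (β * Gam h - 2 * (β * δ))) := by ring
      _ = _ := by rw [← Real.exp_add]; congr 2; ring
  · have a1 := hS.surv_le_evalAt {plusC L} (K * W) (minusC L)
    rw [hS.evalAt_ind_compl] at a1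
    have : 0 ≤ C ^ 2 * z := by positivity
    linarith
  · have a1 := surv_chessSet_mul_le hL β W hq hr K
    have a2 : evalAt (Pmat β h) (K * W) (ind {minusC L}) (minusC L) ≤
        1 - evalAt (Pmat β h) (K * W) (ind {plusC L}) (minusC L) := by
      rw [← hS.evalAt_ind_compl]
      refine hS.evalAt_mono _ (fun v => ?_) _
      by_cases hv : v = minusC L
      · subst hv
        rw [ind_of_mem (A := {plusC L}ᶜ)]
        · exact ind_le_one _ _
        · intro hc
          exact Bool.false_ne_true (congrFun (Set.mem_singleton_iff.1 hc) 0)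
      · rw [ind_of_notMem (by simpa using hv)]; exact ind_nonneg _ _
    have a3 : K * (2 * (4 * C * z ^ 4) + (2 * C * z ^ 2) ^ 2) ≤ 24 * (C ^ 2 * z) := by
      calc _ = (8 * C + 4 * C ^ 2) * (K * z ^ 4) := by ring
        _ ≤ (8 * C ^ 2 + 4 * C ^ 2) * (2 * z) := by gcongr
        _ = _ := by ring
    linarith

/-- The chain does not leave the basin of the all-minus configuration before a time slightly
smaller than `exp (β Γ)`. -/
lemma CopyBounds.le_surv (hB : CopyBounds h L C c Γ') (hL : Even L) (hC : 0 ≤ C) {β ε : ℝ}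
    (hβ : 0 ≤ β) {D : Set (Config L)}
    (hD : D ⊆ {σ | res true σ ∈ Super h L ∨ res false σ ∈ Super h L}) :
    1 - 2 * (C * Real.exp (-(β * ε))) ≤
      surv (Pmat β h) D ⌊Real.exp (β * Gam h - β * ε)⌋₊ (minusC L) := by
  refine one_sub_le_surv hL _ hD fun b => (hB.one_sub_surv_super β hβ b _).trans ?_
  have h1 := Nat.floor_le (Real.exp_pos (β * Gam h - β * ε)).le
  rw [mul_assoc]
  calc _ ≤ C * (Real.exp (β * Gam h - β * ε) * Real.exp (-(β * Gam h))) := by gcongr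
    _ = _ := by rw [← Real.exp_add]; congr 2; ring

lemma tendsto_exp_neg_mul {δ : ℝ} (hδ : 0 < δ) :
    Tendsto (fun β : ℝ => Real.exp (-(β * δ))) atTop (nhds 0) :=
  Real.tendsto_exp_neg_atTop_nhds_zero.comp (tendsto_id.atTop_mul_const hδ)

lemma tendsto_probTauIn_of_surv_le (hB : CopyBounds h L C c Γ') (hL : Even L) (hC : 0 ≤ C)
    {ε δ : ℝ} (hδ : 0 < δ) (hδε : δ < ε) {D : Set (Config L)}
    (hD : D ⊆ {σ | res true σ ∈ Super h L ∨ res false σ ∈ Super h L})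
    (hup : ∀ β : ℝ, 0 ≤ β → ∃ t : ℕ, (t : ℝ) ≤ 4 * Real.exp (β * Gam h + β * δ) ∧
      surv (Pmat β h) D t (minusC L) ≤ 28 * C ^ 2 * Real.exp (-(β * δ))) :
    Tendsto (fun β : ℝ => probTauIn β h (minusC L) D
      (Set.Ioo (Real.exp (β * Gam h - β * ε)) (Real.exp (β * Gam h + β * ε))))
      atTop (nhds 1) := by
  have hlim : Tendsto (fun β : ℝ => 1 - 2 * (C * Real.exp (-(β * ε))) -
      28 * C ^ 2 * Real.exp (-(β * δ))) atTop (nhds 1) := by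
    simpa using (((tendsto_exp_neg_mul (hδ.trans hδε)).const_mul C).const_mul 2).const_sub 1
      |>.sub ((tendsto_exp_neg_mul hδ).const_mul (28 * C ^ 2))
  refine tendsto_of_tendsto_of_tendsto_of_le_of_le' hlim tendsto_const_nhds ?_
    (Eventually.of_forall fun β => probTauIn_Ioo_le_one (isStochastic_Pmat hL β h) _ _ _ _)
  have h4 : ∀ᶠ β : ℝ in atTop, 4 < Real.exp (β * (ε - δ)) :=
    (Real.tendsto_exp_atTop.comp
      (tendsto_id.atTop_mul_const (sub_pos.2 hδε))).eventually_gt_atTop 4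
  filter_upwards [h4, eventually_ge_atTop 0] with β hβ4 hβ
  obtain ⟨t, ht, hsurv⟩ := hup β hβ
  have h1 := hB.le_surv hL hC (ε := ε) hβ hD
  have h2 : (t : ℝ) < Real.exp (β * Gam h + β * ε) := by
    refine ht.trans_lt ?_
    calc 4 * Real.exp (β * Gam h + β * δ) <
          Real.exp (β * (ε - δ)) * Real.exp (β * Gam h + β * δ) := by gcongr
      _ = _ := by rw [← Real.exp_add]; congr 1; ring
  have h3 := surv_sub_surv_le_probTauIn (isStochastic_Pmat hL β h) D (minusC L)
    (Nat.lt_floor_add_one (Real.exp (β * Gam h - β * ε))) h2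
  linarith

end HittingTimeBounds

/-- Theorem 3.9, parts iii–iv: starting from `-1`, both the
hitting time of the chessboards and the hitting time of `+1` are of order
`exp{βΓ}`. -/
theorem exit_time_from_minus :
    ∃ h₀ : ℝ, 0 < h₀ ∧ h₀ ≤ 2 ∧
    ∀ h : ℝ, 0 < h → h < h₀ → (∀ z : ℤ, (z : ℝ) ≠ 2 / h) →
    ∃ L₀ : ℕ, ∀ (L : ℕ) [NeZero L], Even L → L₀ ≤ L →
      ∀ ε : ℝ, 0 < ε →
        Tendsto (fun β : ℝ => probTauIn β h (minusC L) (chessSet L)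
            (Set.Ioo (Real.exp (β * Gam h - β * ε)) (Real.exp (β * Gam h + β * ε))))
          atTop (nhds 1) ∧
        Tendsto (fun β : ℝ => probTauIn β h (minusC L) {plusC L}
            (Set.Ioo (Real.exp (β * Gam h - β * ε)) (Real.exp (β * Gam h + β * ε))))
          atTop (nhds 1) := by
  refine ⟨1, one_pos, one_le_two, fun h h0 h1 _ => ?_⟩
  obtain ⟨L₀, Γ', hNL₀, hΓ'0, hΓ', hbounds⟩ := exists_copyBounds h0 h1
  refine ⟨L₀, fun L _ hL hL₀ ε hε => ?_⟩
  obtain ⟨C, c, hC, hc, hB⟩ := hbounds L hL hL₀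
  have hNL : critN h < L := by omega
  obtain ⟨δ, hδ, hδ'⟩ : ∃ δ : ℝ, 0 < δ ∧ δ < min ε (min ((Gam h - Γ') / 10) (c / 10)) :=
    exists_between (lt_min hε (lt_min (by linarith) (by linarith)))
  simp only [lt_min_iff] at hδ'
  obtain ⟨hδε, hδΓ, hδc⟩ := hδ'
  have hup := fun (β : ℝ) (hβ : 0 ≤ β) => hB.exists_surv_le hL h0 hNL hC hβ hδ hΓ'0
    (by linarith) (by linarith)
  have hplus := res_plusC_mem_Super (L := L) h0 hL hNL
  constructor
  · refine tendsto_probTauIn_of_surv_le hB hL (by linarith) hδ hδε ?_ fun β hβ => ?_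
    · rintro σ (rfl | rfl)
      · left
        rw [res_chessE]
        exact hplus true
      · right
        rw [res_chessO]
        exact hplus false
    · obtain ⟨t, ht, -, hs⟩ := hup β hβ
      exact ⟨t, ht, hs⟩
  · refine tendsto_probTauIn_of_surv_le hB hL (by linarith) hδ hδε ?_ fun β hβ => ?_
    · rintro σ rfl
      exact Or.inl (hplus true)
    · obtain ⟨t, ht, hs, -⟩ := hup β hβ
      exact ⟨t, ht, hs⟩

end PCA
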